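/- arXiv:2010.14960 — 12 statements merged into one kernel-verified Lean document; each statement's English description precedes it below -/
import Mathlib

section
/- Let M_1 < M_2 < ⋯ be a strictly increasing sequence of positive integers such that lim_{k→∞} (1/k²) ∑_{i=1}^k log M_i = 0, and set N_0 := 1, N_k := M_1⋯M_k. Then the set 𝒮 := {N_a + N_b : 0 ≤ a < b} satisfies lim_{N→∞} |𝒮[N]| / log N = ∞, where 𝒮[N] := {n ∈ 𝒮 : n ≤ N}. -/
open Filter

section PartialProducts

variable {M N : ℕ → ℕ}

lemma succ_le_of_strictMono_of_pos (hpos : ∀ i, 0 < M i) (hmono : StrictMono M) (i : ℕ) :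
    i + 1 ≤ M i := by
  induction i with
  | zero => exact hpos 0
  | succ k ih => exact Nat.succ_le_of_lt (ih.trans_lt (hmono k.lt_succ_self))

lemma prod_range_pos (hpos : ∀ i, 0 < M i) (hN : ∀ k, N k = ∏ i ∈ Finset.range k, M i) (k : ℕ) :
    0 < N k := by
  rw [hN]
  exact Finset.prod_pos fun i _ => hpos i

lemma prod_range_succ_eq (hN : ∀ k, N k = ∏ i ∈ Finset.range k, M i) (k : ℕ) :
    N (k + 1) = N k * M k := by
  rw [hN, hN, Finset.prod_range_succ]

lemma prod_range_monotone (hpos : ∀ i, 0 < M i)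
    (hN : ∀ k, N k = ∏ i ∈ Finset.range k, M i) : Monotone N :=
  monotone_nat_of_le_succ fun k => by
    rw [prod_range_succ_eq hN]
    exact Nat.le_mul_of_pos_right _ (hpos k)

lemma two_mul_prod_range_le (hpos : ∀ i, 0 < M i) (hmono : StrictMono M)
    (hN : ∀ k, N k = ∏ i ∈ Finset.range k, M i) (k : ℕ) :
    2 * N (k + 1) ≤ N (k + 2) := by
  rw [prod_range_succ_eq hN (k + 1), mul_comm]
  have := succ_le_of_strictMono_of_pos hpos hmono (k + 1)
  exact Nat.mul_le_mul_left _ (by omega)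

lemma le_prod_range (hpos : ∀ i, 0 < M i) (hmono : StrictMono M)
    (hN : ∀ k, N k = ∏ i ∈ Finset.range k, M i) (k : ℕ) : k ≤ N k := by
  cases k with
  | zero => exact Nat.zero_le _
  | succ k =>
    rw [prod_range_succ_eq hN]
    exact (succ_le_of_strictMono_of_pos hpos hmono k).trans
      (Nat.le_mul_of_pos_left _ (prod_range_pos hpos hN k))

lemma log_prod_range (hpos : ∀ i, 0 < M i)
    (hN : ∀ k, N k = ∏ i ∈ Finset.range k, M i) (k : ℕ) :
    Real.log (N k) = ∑ i ∈ Finset.range k, Real.log (M i) := by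
  rw [hN, Nat.cast_prod, Real.log_prod]
  exact fun i _ => Nat.cast_ne_zero.2 (hpos i).ne'

lemma add_lt_add_of_snd_lt (hpos : ∀ i, 0 < M i) (hmono : StrictMono M)
    (hN : ∀ k, N k = ∏ i ∈ Finset.range k, M i) {a b a' b' : ℕ} (hab : a < b) (hb : b < b') :
    N (a + 1) + N (b + 1) < N (a' + 1) + N (b' + 1) := by
  have h1 := prod_range_monotone hpos hN (show a + 1 ≤ b + 1 by omega)
  have h2 := two_mul_prod_range_le hpos hmono hN b
  have h3 := prod_range_monotone hpos hN (show b + 2 ≤ b' + 1 by omega)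
  have h4 := prod_range_pos hpos hN (a' + 1)
  omega

lemma prod_range_succ_strictMono (hpos : ∀ i, 0 < M i) (hmono : StrictMono M)
    (hN : ∀ k, N k = ∏ i ∈ Finset.range k, M i) : StrictMono fun k => N (k + 1) :=
  strictMono_nat_of_lt_succ fun k => by
    have h1 := two_mul_prod_range_le hpos hmono hN k
    have h2 := prod_range_pos hpos hN (k + 1)
    change N (k + 1) < N (k + 2)
    omega

/-- The sums `N a + N b` with `1 ≤ a < b ≤ k` are distinct and at most `2 * N k`. -/
lemma choose_two_le_ncard (hpos : ∀ i, 0 < M i) (hmono : StrictMono M)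
    (hN : ∀ k, N k = ∏ i ∈ Finset.range k, M i) {k n : ℕ} (hn : 2 * N k ≤ n) :
    k * (k - 1) ≤ 2 * Set.ncard {s ∈ {n | ∃ a b : ℕ, a < b ∧ n = N a + N b} | s ≤ n} := by
  let P : Finset (Σ _ : ℕ, ℕ) := (Finset.range k).sigma fun b => Finset.range b
  let f : (Σ _ : ℕ, ℕ) → ℕ := fun p => N (p.2 + 1) + N (p.1 + 1)
  have hinj : Set.InjOn f P := by
    rintro ⟨b, a⟩ hp ⟨b', a'⟩ hp' h
    simp only [P, Finset.coe_sigma, Set.mem_sigma_iff, Finset.mem_coe, Finset.mem_range] at hp hp'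
    change N (a + 1) + N (b + 1) = N (a' + 1) + N (b' + 1) at h
    rcases lt_trichotomy b b' with hb | rfl | hb
    · exact absurd h (add_lt_add_of_snd_lt hpos hmono hN hp.2 hb).ne
    · rw [(prod_range_succ_strictMono hpos hmono hN).injective (Nat.add_right_cancel h)]
    · exact absurd h (add_lt_add_of_snd_lt hpos hmono hN hp'.2 hb).ne'
  have hsub : (P.image f : Set ℕ) ⊆
      {s ∈ {n | ∃ a b : ℕ, a < b ∧ n = N a + N b} | s ≤ n} := by
    intro s hs
    obtain ⟨⟨b, a⟩, hp, rfl⟩ := Finset.mem_image.1 (Finset.mem_coe.1 hs)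
    simp only [P, Finset.mem_sigma, Finset.mem_range] at hp
    refine ⟨⟨a + 1, b + 1, by omega, rfl⟩, ?_⟩
    have h1 := prod_range_monotone hpos hN (show a + 1 ≤ k by omega)
    have h2 := prod_range_monotone hpos hN (show b + 1 ≤ k by omega)
    change N (a + 1) + N (b + 1) ≤ n
    omega
  have hcard := Set.ncard_le_ncard hsub ((Set.finite_Iic n).subset fun s hs => hs.2)
  rw [Set.ncard_coe_finset, Finset.card_image_of_injOn hinj, Finset.card_sigma] at hcard
  simp only [Finset.card_range] at hcard
  have := Finset.sum_range_id_mul_two k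
  omega

end PartialProducts

/-- If `M 0 < M 1 < ⋯` are positive integers (0-indexed version of `M_1 < M_2 < ⋯`)
with `(1/k²) ∑_{i<k} log M_i → 0`, and `N k = M 0 ⋯ M (k-1)` (so `N 0 = 1`),
then `𝒮 = {N a + N b : a < b}` satisfies `|𝒮[N]| / log N → ∞`. -/
theorem stmt_0 (M : ℕ → ℕ) (hpos : ∀ i, 0 < M i) (hmono : StrictMono M)
    (hlog : Tendsto (fun k : ℕ => (∑ i ∈ Finset.range k, Real.log (M i)) / (k : ℝ) ^ 2)
      atTop (nhds 0))
    (N : ℕ → ℕ) (hN : ∀ k, N k = ∏ i ∈ Finset.range k, M i)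
    (S : Set ℕ) (hS : S = {n | ∃ a b : ℕ, a < b ∧ n = N a + N b}) :
    Tendsto (fun n : ℕ => (Set.ncard {s ∈ S | s ≤ n} : ℝ) / Real.log n) atTop atTop := by
  subst hS
  rw [tendsto_atTop]
  intro C₀
  obtain ⟨C, hC₀, hC⟩ : ∃ C : ℝ, C₀ ≤ C ∧ 0 < C :=
    ⟨max C₀ 1, le_max_left _ _, lt_max_of_lt_right one_pos⟩
  obtain ⟨K₁, hK₁⟩ := eventually_atTop.1
    (hlog.eventually (gt_mem_nhds (show (0 : ℝ) < 1 / (16 * C) by positivity)))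
  obtain ⟨K₂, hK₂⟩ := exists_nat_ge (4 + 4 * C)
  filter_upwards [eventually_ge_atTop (2 * N (max K₁ K₂)), eventually_ge_atTop 2] with n hn hn2
  have hex : ∃ j, n < 2 * N j :=
    ⟨n, by have := le_prod_range hpos hmono hN n; omega⟩
  obtain ⟨k, hk, hlow, hhigh⟩ : ∃ k, max K₁ K₂ ≤ k ∧ 2 * N k ≤ n ∧ n < 2 * N (k + 1) := by
    classical
    have hfind := Nat.find_spec hex
    have hlt : max K₁ K₂ < Nat.find hex := by
      by_contra! h
      have := prod_range_monotone hpos hN h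
      omega
    obtain ⟨k, hk⟩ := Nat.exists_eq_add_of_lt hlt
    refine ⟨max K₁ K₂ + k, Nat.le_add_right _ _, ?_, hk ▸ hfind⟩
    exact not_lt.1 (Nat.find_min hex (by omega))
  have hlogn : 0 < Real.log n := Real.log_pos (by exact_mod_cast hn2)
  have hkC : 4 + 4 * C ≤ (k : ℝ) :=
    hK₂.trans (by exact_mod_cast (le_max_right K₁ K₂).trans hk)
  have hcount : (k : ℝ) * (k - 1) ≤
      2 * (Set.ncard {s ∈ {n | ∃ a b : ℕ, a < b ∧ n = N a + N b} | s ≤ n} : ℝ) := by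
    have hk1 : 1 ≤ k := by
      have : (1 : ℝ) ≤ k := by linarith
      exact_mod_cast this
    have := choose_two_le_ncard hpos hmono hN hlow
    rw [← Nat.cast_one, ← Nat.cast_sub hk1]
    exact_mod_cast this
  have hsum : Real.log (N (k + 1)) ≤ 1 / (16 * C) * ((k : ℝ) + 1) ^ 2 := by
    have := hK₁ (k + 1) (((le_max_left K₁ K₂).trans hk).trans k.le_succ)
    rw [← log_prod_range hpos hN, div_lt_iff₀ (by positivity)] at this
    push_cast at this
    exact this.le
  have hbound : Real.log n ≤ 1 + 1 / (16 * C) * ((k : ℝ) + 1) ^ 2 := by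
    have hNpos : (0 : ℝ) < N (k + 1) := by exact_mod_cast prod_range_pos hpos hN (k + 1)
    calc Real.log n ≤ Real.log (2 * N (k + 1)) :=
          Real.log_le_log (by positivity) (by exact_mod_cast hhigh.le)
      _ = Real.log 2 + Real.log (N (k + 1)) := Real.log_mul two_ne_zero hNpos.ne'
      _ ≤ _ := add_le_add (Real.log_two_lt_d9.le.trans (by norm_num)) hsum
  refine hC₀.trans ((le_div_iff₀ hlogn).2 ?_)
  have hmul : C * Real.log n ≤ C + ((k : ℝ) + 1) ^ 2 / 16 :=
    (mul_le_mul_of_nonneg_left hbound hC.le).trans_eq (by field_simp)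
  have hquad : C + ((k : ℝ) + 1) ^ 2 / 16 ≤ (k : ℝ) * (k - 1) / 2 := by
    nlinarith [mul_nonneg (show (0 : ℝ) ≤ k by positivity) (show (0 : ℝ) ≤ k - 4 by linarith)]
  exact (hmul.trans hquad).trans ((div_le_iff₀' two_pos).2 hcount)
end

section
/- Suppose each M_i is divisible by 3 and M_i ≥ 6 (so each M_i − 3 is a positive multiple of 3). Let k ≥ 3 and let 1 ≤ a < b ≤ k. Then the average over x ∈ Ω̃_k of ψ(∑_{i ≤ k, i ≠ a, i ≠ b} x_i) equals −1/3; that is, (1/|Ω̃_k|) ∑_{x ∈ Ω̃_k} ψ(x_1 + ⋯ + x̂_a + ⋯ + x̂_b + ⋯ + x_k) = −1/3, where the hats indicate that the coordinates x_a and x_b are omitted from the sum. -/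
/-- If a permutation of a finite set shifts `f` by one modulo three, then the function `ψ ∘ f`, with
`ψ` equal to `1` on multiples of three and `-1` elsewhere, has average `-1/3`. -/
theorem three_mul_sum_of_shift_mod_three {α : Type*} (S : Finset α) (σ : α → α)
    (hσ : Set.MapsTo σ S S) (hinj : Set.InjOn σ S) (f : α → ℤ)
    (hf : ∀ x ∈ S, f (σ x) % 3 = (f x + 1) % 3)
    (ψ : ℤ → ℝ) (hψ : ∀ n : ℤ, ψ n = if n % 3 = 0 then 1 else -1) :
    3 * ∑ x ∈ S, ψ (f x) = -(S.card : ℝ) := by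
  have hsurj : Set.SurjOn σ S S := Finset.surjOn_of_injOn_of_card_le σ hσ hinj le_rfl
  have shift (g : α → ℝ) : ∑ x ∈ S, g (σ x) = ∑ x ∈ S, g x :=
    Finset.sum_nbij σ hσ hinj hsurj fun _ _ => rfl
  have h₁ := shift fun x => ψ (f x)
  have h₂ := shift fun x => ψ (f (σ x))
  have h₃ : ∑ x ∈ S, (ψ (f x) + ψ (f (σ x)) + ψ (f (σ (σ x)))) = ∑ x ∈ S, (-1 : ℝ) := by
    refine Finset.sum_congr rfl fun x hx => ?_
    have e₁ := hf x hx
    have e₂ := hf (σ x) (hσ hx)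
    rw [hψ, hψ, hψ]
    split_ifs <;> first | omega | norm_num
  simp only [Finset.sum_add_distrib, Finset.sum_const, nsmul_eq_mul] at h₃
  linarith

/-- Rotating one coordinate of a finitely supported function by one step modulo `N`. -/
noncomputable def rotateCoord (c N : ℕ) (x : ℕ →₀ ℕ) : ℕ →₀ ℕ :=
  x.update c ((x c + 1) % N)

theorem rotateCoord_apply_self (c N : ℕ) (x : ℕ →₀ ℕ) :
    rotateCoord c N x c = (x c + 1) % N := by
  simp [rotateCoord]

theorem rotateCoord_apply_of_ne {c i : ℕ} (N : ℕ) (x : ℕ →₀ ℕ) (h : i ≠ c) :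
    rotateCoord c N x i = x i := by
  simp [rotateCoord, h]

theorem rotateCoord_injOn (c N : ℕ) : Set.InjOn (rotateCoord c N) {x | x c < N} := by
  intro x hx y hy hxy
  ext i
  have hi := DFunLike.congr_fun hxy i
  rcases eq_or_ne i c with rfl | hne
  · rw [rotateCoord_apply_self, rotateCoord_apply_self] at hi
    exact (Nat.ModEq.add_right_cancel' 1 hi).eq_of_lt_of_lt hx hy
  · rwa [rotateCoord_apply_of_ne N x hne, rotateCoord_apply_of_ne N y hne] at hi

theorem sum_rotateCoord_mod_three {c N : ℕ} (hN : 3 ∣ N) (x : ℕ →₀ ℕ) {T : Finset ℕ}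
    (hc : c ∈ T) :
    (∑ i ∈ T, (rotateCoord c N x i : ℤ)) % 3 = (∑ i ∈ T, (x i : ℤ) + 1) % 3 := by
  have hrest : ∑ i ∈ T.erase c, (rotateCoord c N x i : ℤ) = ∑ i ∈ T.erase c, (x i : ℤ) :=
    Finset.sum_congr rfl fun i hi => by
      rw [rotateCoord_apply_of_ne N x (Finset.ne_of_mem_erase hi)]
  have hmod : (x c + 1) % N % 3 = (x c + 1) % 3 := Nat.mod_mod_of_dvd _ hN
  rw [← Finset.add_sum_erase T _ hc, ← Finset.add_sum_erase T (fun i => (x i : ℤ)) hc, hrest,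
    rotateCoord_apply_self]
  omega

/-- If each `M i` is a multiple of `3` with `M i ≥ 6`, `k ≥ 3` and `a < b < k`
(0-indexed version of `1 ≤ a < b ≤ k`), then the average over `x ∈ Ω̃ k` of
`ψ(∑_{i < k, i ≠ a, i ≠ b} x i)` equals `−1/3`, where `ψ` is periodic mod 3
with `ψ(0) = 1`, `ψ(1) = ψ(2) = −1`. -/
theorem stmt_4 (M : ℕ → ℕ) (hmono : StrictMono M) (hdiv : ∀ i, 3 ∣ M i)
    (h6 : ∀ i, 6 ≤ M i)
    (Ωt : ℕ → Set (ℕ →₀ ℕ))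
    (hΩt : ∀ k, Ωt k = {x | (∀ i, i < k → x i < M i - 3) ∧ ∀ i, k ≤ i → x i = 0})
    (ψ : ℤ → ℝ) (hψ : ∀ n : ℤ, ψ n = if n % 3 = 0 then 1 else -1)
    (k a b : ℕ) (hk : 3 ≤ k) (hab : a < b) (hbk : b < k) :
    (∑ᶠ x ∈ Ωt k, ψ (∑ i ∈ ((Finset.range k).erase a).erase b, (x i : ℤ))) /
      (Set.ncard (Ωt k) : ℝ) = -1 / 3 := by
  let S : Finset (ℕ →₀ ℕ) := (Finset.range k).finsupp fun i => Finset.range (M i - 3)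
  have hmem (x : ℕ →₀ ℕ) :
      x ∈ S ↔ (∀ i, i < k → x i < M i - 3) ∧ ∀ i, k ≤ i → x i = 0 := by
    simp only [S, Finset.mem_finsupp_iff, Finset.mem_range, Finset.subset_iff,
      Finsupp.mem_support_iff]
    exact ⟨fun h => ⟨h.2, fun i hi => by_contra fun hx => absurd (h.1 hx) (by omega)⟩,
      fun h => ⟨fun i hi => by_contra fun hx => hi (h.2 i (by omega)), h.1⟩⟩
  have hS : Ωt k = S := by
    ext x
    rw [hΩt, Finset.mem_coe, hmem, Set.mem_ofPred_eq]
  obtain ⟨c, hc⟩ : (((Finset.range k).erase a).erase b).Nonempty := by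
    rw [← Finset.card_pos, Finset.card_erase_of_mem (by simp; omega),
      Finset.card_erase_of_mem (by simp; omega), Finset.card_range]
    omega
  have hck : c < k := Finset.mem_range.1 (Finset.mem_of_mem_erase (Finset.mem_of_mem_erase hc))
  have hN : 3 ∣ M c - 3 := Nat.dvd_sub (hdiv c) dvd_rfl
  have hpos : 0 < M c - 3 := by have := h6 c; omega
  have hmaps : Set.MapsTo (rotateCoord c (M c - 3)) S S := by
    intro x hx
    rw [Finset.mem_coe, hmem] at hx ⊢
    refine ⟨fun i hi => ?_, fun i hi => ?_⟩
    · rcases eq_or_ne i c with rfl | hne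
      · rw [rotateCoord_apply_self]
        exact Nat.mod_lt _ hpos
      · rw [rotateCoord_apply_of_ne _ _ hne]
        exact hx.1 i hi
    · rw [rotateCoord_apply_of_ne _ _ (by omega)]
      exact hx.2 i hi
  have hinj : Set.InjOn (rotateCoord c (M c - 3)) S :=
    (rotateCoord_injOn c (M c - 3)).mono fun x hx => ((hmem x).1 hx).1 c hck
  have key := three_mul_sum_of_shift_mod_three S _ hmaps hinj
    (fun x => ∑ i ∈ ((Finset.range k).erase a).erase b, (x i : ℤ))
    (fun x _ => sum_rotateCoord_mod_three hN x hc) ψ hψ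
  have hcard : (S.card : ℝ) ≠ 0 := by
    refine Nat.cast_ne_zero.2 (Finset.card_ne_zero_of_mem ((hmem 0).2 ⟨fun i _ => ?_, by simp⟩))
    have := h6 i
    simp only [Finsupp.coe_zero, Pi.zero_apply]
    omega
  rw [hS, finsum_mem_coe_finset, Set.ncard_coe_finset, div_eq_div_iff hcard three_ne_zero]
  linarith
end

section
/- Let y ∈ Σ_k and d := β(y). Then S_k(d) = (1/|Ω_k|) ∑_{x ∈ Ω_k} 1_{Ω̃_k}(x) ψ(σ_y(x)) if y ∈ Σ_k^−, and S_k(d) = |Ω̃_k| / |Ω_k| if y ∈ Σ_k^+. -/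
open scoped Classical

/-- A mixed-radix expansion with digits `x i < M i` for `i < k` is less than `∏ i < k, M i`. -/
lemma mixedRadix_sum_lt (M x : ℕ → ℕ) (k : ℕ) (hx : ∀ i < k, x i < M i) :
    ∑ i ∈ Finset.range k, (∏ j ∈ Finset.range i, M j) * x i < ∏ j ∈ Finset.range k, M j := by
  induction k with
  | zero => simp
  | succ k ih =>
    rw [Finset.sum_range_succ, Finset.prod_range_succ]
    have h1 := ih fun i hi => hx i (by lia)
    have h2 : x k + 1 ≤ M k := hx k (by lia)
    nlinarith [Nat.mul_le_mul_left (∏ j ∈ Finset.range k, M j) h2]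

/-- The digits of a mixed-radix expansion are determined by its value. -/
lemma mixedRadix_digits_eq (M x y : ℕ → ℕ) (k : ℕ) (hx : ∀ i < k, x i < M i)
    (hy : ∀ i < k, y i < M i)
    (h : ∑ i ∈ Finset.range k, (∏ j ∈ Finset.range i, M j) * x i =
      ∑ i ∈ Finset.range k, (∏ j ∈ Finset.range i, M j) * y i) :
    ∀ i < k, x i = y i := by
  induction k with
  | zero => simp
  | succ k ih =>
    rw [Finset.sum_range_succ, Finset.sum_range_succ] at h
    have h1 := mixedRadix_sum_lt M x k fun i hi => hx i (by lia)
    have h2 := mixedRadix_sum_lt M y k fun i hi => hy i (by lia)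
    have hm := congrArg (· % ∏ j ∈ Finset.range k, M j) h
    simp only [Nat.add_mul_mod_self_left, Nat.mod_eq_of_lt h1, Nat.mod_eq_of_lt h2] at hm
    rw [hm, Nat.add_left_cancel_iff] at h
    have hk := Nat.eq_of_mul_eq_mul_left (by lia) h
    intro i hi
    rcases Nat.lt_succ_iff_lt_or_eq.mp hi with hi | rfl
    · exact ih (fun i hi => hx i (by lia)) (fun i hi => hy i (by lia)) hm i hi
    · exact hk

/-- Every `n < ∏ i < k, M i` has a mixed-radix expansion. -/
lemma exists_mixedRadix_digits (M : ℕ → ℕ) (hM : ∀ i, 0 < M i) (k n : ℕ)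
    (hn : n < ∏ j ∈ Finset.range k, M j) :
    ∃ x : ℕ →₀ ℕ, (∀ i, x i < M i) ∧ (∀ i, k ≤ i → x i = 0) ∧
      ∑ i ∈ Finset.range k, (∏ j ∈ Finset.range i, M j) * x i = n := by
  refine ⟨Finsupp.onFinset (Finset.range k)
    (fun i => if i < k then n / (∏ j ∈ Finset.range i, M j) % M i else 0) (by simp; lia), ?_, ?_, ?_⟩
  · intro i
    simp only [Finsupp.onFinset_apply]
    split_ifs
    · exact Nat.mod_lt _ (hM i)
    · exact hM i
  · intro i hi
    simp [Nat.not_lt.mpr hi]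
  · have key : ∀ m, ∑ i ∈ Finset.range m,
        (∏ j ∈ Finset.range i, M j) * (n / (∏ j ∈ Finset.range i, M j) % M i) =
        n % ∏ j ∈ Finset.range m, M j := by
      intro m
      induction m with
      | zero => simp [Nat.mod_one]
      | succ m ih => rw [Finset.sum_range_succ, Finset.prod_range_succ, Nat.mod_mul, ih]
    refine Eq.trans (Finset.sum_congr rfl fun i hi => ?_) ((key k).trans (Nat.mod_eq_of_lt hn))
    rw [Finsupp.onFinset_apply, if_pos (Finset.mem_range.mp hi)]

/-- The mixed-radix expansion is a bijection from digit sequences of length `k` onto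
`{0, …, ∏ i < k, M i - 1}`. -/
lemma mixedRadix_bijOn (M : ℕ → ℕ) (hM : ∀ i, 0 < M i) (k : ℕ) :
    Set.BijOn (fun x : ℕ →₀ ℕ => ∑ i ∈ x.support, (∏ j ∈ Finset.range i, M j) * x i)
      {x | (∀ i, x i < M i) ∧ ∀ i, k ≤ i → x i = 0}
      (Finset.range (∏ j ∈ Finset.range k, M j)) := by
  have hsum : ∀ x : ℕ →₀ ℕ, (∀ i, k ≤ i → x i = 0) →
      ∑ i ∈ x.support, (∏ j ∈ Finset.range i, M j) * x i =
      ∑ i ∈ Finset.range k, (∏ j ∈ Finset.range i, M j) * x i := by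
    intro x hx
    refine Finset.sum_subset (fun i hi => ?_) (fun i _ hi => ?_)
    · by_contra h
      exact Finsupp.mem_support_iff.mp hi (hx i (by simpa using h))
    · rw [Finsupp.notMem_support_iff.mp hi, mul_zero]
  refine ⟨fun x hx => ?_, fun x hx y hy h => ?_, fun n hn => ?_⟩
  · simpa [hsum x hx.2] using mixedRadix_sum_lt M x k fun i _ => hx.1 i
  · simp only [hsum x hx.2, hsum y hy.2] at h
    ext i
    by_cases hi : i < k
    · exact mixedRadix_digits_eq M x y k (fun i _ => hx.1 i) (fun i _ => hy.1 i) h i hi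
    · rw [hx.2 i (by lia), hy.2 i (by lia)]
  · obtain ⟨x, h1, h2, h3⟩ := exists_mixedRadix_digits M hM k n (by simpa using hn)
    exact ⟨x, ⟨h1, h2⟩, by simp only [hsum x h2, h3]⟩

/-- For two sums of two distinct unit vectors, the sum of the coordinates of the second one over
the complement of the support of the first is `1` or `2` unless they agree. -/
lemma sum_pair_off_pair (k : ℕ) (z y : ℕ →₀ ℕ)
    (hz : ∃ a b : ℕ, a < b ∧ b < k ∧ z = Finsupp.single a 1 + Finsupp.single b 1)
    (hy : ∃ a b : ℕ, a < b ∧ b < k ∧ y = Finsupp.single a 1 + Finsupp.single b 1)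
    (hne : z ≠ y) :
    ∑ i ∈ (Finset.range k).filter (fun i => z i = 0), (y i : ℤ) = 1 ∨
    ∑ i ∈ (Finset.range k).filter (fun i => z i = 0), (y i : ℤ) = 2 := by
  obtain ⟨a, b, hab, hb, rfl⟩ := hz
  obtain ⟨c, e, hce, he, rfl⟩ := hy
  have hne' : ¬(a = c ∧ b = e) := by
    rintro ⟨rfl, rfl⟩
    exact hne rfl
  have hc : c < k := by lia
  simp only [Finsupp.add_apply, Finsupp.single_apply, Nat.cast_add, Nat.cast_ite, Nat.cast_one,
    Nat.cast_zero, Finset.sum_add_distrib, Finset.sum_ite_eq, Finset.mem_filter, Finset.mem_range]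
  split_ifs <;> lia

/-- The product of the values of `ψ` along a progression modulo `3` whose step is invertible. -/
lemma prod_three_term_of_step (ψ : ℤ → ℝ) (hψ : ∀ n : ℤ, ψ n = if n % 3 = 0 then 1 else -1)
    (s t : ℤ) (ht : t = 1 ∨ t = 2) : ψ s * ψ (s + t) * ψ (s + 2 * t) = 1 := by
  simp only [hψ]
  rcases ht with rfl | rfl <;> split_ifs <;> first | lia | norm_num

lemma sign_cubed (ψ : ℤ → ℝ) (hψ : ∀ n : ℤ, ψ n = if n % 3 = 0 then 1 else -1) (s : ℤ) :
    ψ s * ψ s * ψ s = ψ s := by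
  rw [hψ]
  split_ifs <;> norm_num

/-- Equation (4.2) of the paper: for `y ∈ Σ k` and `d = β y`, the finitary
correlation average `S_k(d)` equals `𝔼_{x ∈ Ω k} 1_{Ω̃ k}(x) ψ(σ_y(x))` if
`y ∈ Σ_k^−`, and `|Ω̃ k| / |Ω k|` if `y ∈ Σ_k^+ = Σ k \ Σ_k^−`.
Everything is 0-indexed: `M i` stands for `M_{i+1}`, `N k = M_1 ⋯ M_k`. -/
theorem stmt_5 (M : ℕ → ℕ) (hmono : StrictMono M) (hpos : ∀ i, 0 < M i)
    (hdiv : ∀ i, 3 ∣ M i)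
    (N : ℕ → ℕ) (hN : ∀ k, N k = ∏ i ∈ Finset.range k, M i)
    (Ω Ωt Sig : ℕ → Set (ℕ →₀ ℕ))
    (hΩ : ∀ k, Ω k = {x | (∀ i, x i < M i) ∧ ∀ i, k ≤ i → x i = 0})
    (hΩt : ∀ k, Ωt k = {x | (∀ i, i < k → x i < M i - 3) ∧ ∀ i, k ≤ i → x i = 0})
    (hSig : ∀ k, Sig k = {z | ∃ a b : ℕ, a < b ∧ b < k ∧
      z = Finsupp.single a 1 + Finsupp.single b 1})
    (β : (ℕ →₀ ℕ) → ℕ) (hβ : ∀ x, β x = ∑ i ∈ x.support, N i * x i)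
    (S : Set ℕ) (hS : S = {n | ∃ a b : ℕ, a < b ∧ n = N a + N b})
    (ψ : ℤ → ℝ) (hψ : ∀ n : ℤ, ψ n = if n % 3 = 0 then 1 else -1)
    (η : ℕ → ℝ) (hη : ∀ n ∈ S, η n = 1 ∨ η n = -1/3)
    (k : ℕ)
    (Sigm : Set (ℕ →₀ ℕ)) (hSigm : Sigm = {z ∈ Sig k | η (β z) = -1/3})
    (σ : (ℕ →₀ ℕ) → (ℕ →₀ ℕ) → ℤ)
    (hσ : ∀ z x, σ z x = ∑ i ∈ (Finset.range k).filter (fun i => z i = 0), (x i : ℤ))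
    (f ft : ℕ → ℝ)
    (hf : ∀ x ∈ Ω k, f (β x) = ∏ᶠ z ∈ Sigm, ψ (σ z x))
    (hf0 : ∀ n, N k ≤ n → f n = 0)
    (hft1 : ∀ x ∈ Ωt k, ft (β x) = f (β x))
    (hft2 : ∀ x ∈ Ω k \ Ωt k, ft (β x) = 0)
    (hft0 : ∀ n, N k ≤ n → ft n = 0)
    (y : ℕ →₀ ℕ) (hy : y ∈ Sig k) (d : ℕ) (hd : d = β y)
    (Sk : ℝ)
    (hSk : Sk = (∑ n ∈ Finset.range (N k), ft n * f (n + d) * f (n + 2 * d)) / (N k : ℝ)) :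
    (y ∈ Sigm →
      Sk = (∑ᶠ x ∈ Ω k, (if x ∈ Ωt k then (1 : ℝ) else 0) * ψ (σ y x)) /
        (Set.ncard (Ω k) : ℝ)) ∧
    (y ∉ Sigm → Sk = (Set.ncard (Ωt k) : ℝ) / (Set.ncard (Ω k) : ℝ)) := by
  have hN' : N = fun k => ∏ i ∈ Finset.range k, M i := funext hN
  have hβ' : β = fun x : ℕ →₀ ℕ => ∑ i ∈ x.support, (∏ j ∈ Finset.range i, M j) * x i := by
    funext x
    rw [hβ, hN']
  have hbij : Set.BijOn β (Ω k) (Finset.range (N k)) := by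
    rw [hβ', hΩ, hN]
    exact mixedRadix_bijOn M hpos k
  have hβadd : ∀ x z, β (x + z) = β x + β z := fun x z => by
    simp only [hβ]
    exact Finsupp.sum_add_index' (h := fun i m => N i * m) (by simp) (by simp [mul_add])
  have hΩfin : (Ω k).Finite := hbij.finite_iff_finite.mpr (Finset.finite_toSet _)
  have hcard : (Ω k).ncard = N k := by
    rw [← hbij.injOn.ncard_image, hbij.image_eq, Set.ncard_coe_finset, Finset.card_range]
  have hy' := hy
  rw [hSig] at hy'
  have hyle : ∀ i, y i ≤ 1 := by
    obtain ⟨a, b, hab, -, rfl⟩ := hy'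
    intro i
    simp only [Finsupp.add_apply, Finsupp.single_apply]
    split_ifs <;> lia
  have hy0 : ∀ i, k ≤ i → y i = 0 := by
    obtain ⟨a, b, hab, hb, rfl⟩ := hy'
    intro i hi
    simp only [Finsupp.add_apply, Finsupp.single_apply]
    split_ifs <;> lia
  have hΩtadd : ∀ x ∈ Ωt k, ∀ j ≤ 2, x + j • y ∈ Ω k := by
    intro x hx j hj
    rw [hΩt] at hx
    rw [hΩ]
    refine ⟨fun i => ?_, fun i hi => by simp [hx.2 i hi, hy0 i hi]⟩
    rw [Finsupp.add_apply, Finsupp.smul_apply, smul_eq_mul]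
    by_cases hi : i < k
    · have h1 := hx.1 i hi
      have h2 : j * y i ≤ 2 * 1 := Nat.mul_le_mul hj (hyle i)
      lia
    · rw [hx.2 i (by lia), hy0 i (by lia)]
      simpa using hpos i
  have hsub : Ωt k ⊆ Ω k := fun x hx => by simpa using hΩtadd x hx 0 (by lia)
  have hSigfin : Sigm.Finite := by
    refine Set.Finite.subset (Set.toFinite (Set.image
      (fun p : ℕ × ℕ => Finsupp.single p.1 1 + Finsupp.single p.2 1)
      (Finset.range k ×ˢ Finset.range k : Finset (ℕ × ℕ)))) ?_
    rw [hSigm, hSig]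
    rintro z ⟨⟨a, b, hab, hb, rfl⟩, -⟩
    exact ⟨(a, b), by simp; lia, rfl⟩
  have hσadd : ∀ z x (j : ℕ), σ z (x + j • y) = σ z x + j * σ z y := by
    intro z x j
    simp [hσ, Finset.sum_add_distrib, Finset.mul_sum]
  have hσyy : σ y y = 0 := by
    rw [hσ]
    exact Finset.sum_eq_zero fun i hi => by simp [(Finset.mem_filter.mp hi).2]
  have hfactor : ∀ x, ∀ z ∈ Sigm, ψ (σ z x) * ψ (σ z (x + 1 • y)) * ψ (σ z (x + 2 • y)) =
      if z = y then ψ (σ y x) else 1 := by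
    intro x z hz
    rw [hσadd, hσadd]
    push_cast
    rw [one_mul]
    split_ifs with h
    · rw [h, hσyy, mul_zero, add_zero, sign_cubed ψ hψ]
    · refine prod_three_term_of_step ψ hψ _ _ ?_
      rw [hσ]
      rw [hSigm, hSig] at hz
      exact sum_pair_off_pair k z y hz.1 hy' h
  have hterm : ∀ x ∈ Ω k, (if x ∈ Ωt k then (1 : ℝ) else 0) *
      (if y ∈ Sigm then ψ (σ y x) else 1) = ft (β x) * f (β x + d) * f (β x + 2 * d) := by
    intro x hx
    by_cases hxt : x ∈ Ωt k
    · have h1 : β x + d = β (x + 1 • y) := by rw [one_smul, hβadd, hd]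
      have h2 : β x + 2 * d = β (x + 2 • y) := by rw [two_smul, hβadd, hβadd, hd, two_mul]
      rw [if_pos hxt, one_mul, hft1 x hxt, h1, h2, hf x hx, hf _ (hΩtadd x hxt 1 (by lia)),
        hf _ (hΩtadd x hxt 2 le_rfl), ← finprod_mem_mul_distrib hSigfin,
        ← finprod_mem_mul_distrib hSigfin, finprod_mem_congr rfl (hfactor x),
        finprod_mem_eq_finite_toFinset_prod _ hSigfin, Finset.prod_ite_eq']
      simp
    · rw [if_neg hxt, hft2 x ⟨hx, hxt⟩]
      ring
  have hsum : Sk = (∑ᶠ x ∈ Ω k, (if x ∈ Ωt k then (1 : ℝ) else 0) *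
      (if y ∈ Sigm then ψ (σ y x) else 1)) / ((Ω k).ncard : ℝ) := by
    rw [hSk, hcard, finsum_mem_eq_of_bijOn β hbij hterm
      (g := fun n => ft n * f (n + d) * f (n + 2 * d)), finsum_mem_coe_finset]
  refine ⟨fun h => ?_, fun h => ?_⟩
  · simpa only [if_pos h] using hsum
  · rw [hsum]
    simp only [if_neg h, mul_one]
    rw [finsum_mem_eq_finite_toFinset_sum _ hΩfin, Finset.sum_boole, ← Set.ncard_coe_finset]
    congr 3
    ext x
    simpa using fun hx => hsub hx
end

section
/- For every d ∈ 𝒮, the limit lim_{k→∞} S_k(d) exists and equals γ · η(d). -/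
open Filter

section MixedRadix

/-- Summation over `0 ≤ n < M 0 * ⋯ * M (k - 1)` through mixed radix digits. -/
lemma sum_range_prod_eq_sum_digits (M : ℕ → ℕ) (k : ℕ) (G : ℕ → ℝ) :
    ∑ n ∈ Finset.range (∏ i ∈ Finset.range k, M i), G n =
      ∑ y : (∀ i : Fin k, Fin (M i)),
        G (∑ i : Fin k, (∏ j ∈ Finset.range i, M j) * (y i : ℕ)) := by
  rw [← Fin.prod_univ_eq_prod_range, Finset.sum_range,
    ← (finPiFinEquiv (n := fun i : Fin k => M i)).sum_comp]
  refine Finset.sum_congr rfl fun y _ => ?_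
  rw [finPiFinEquiv_apply]
  congr 1
  refine Finset.sum_congr rfl fun i _ => ?_
  rw [mul_comm, ← Fin.prod_univ_eq_prod_range]
  rfl

/-- The finitely supported sequence whose first `k` entries are the digits `y`. -/
noncomputable def digitsFinsupp {M : ℕ → ℕ} {k : ℕ} (y : ∀ i : Fin k, Fin (M i)) : ℕ →₀ ℕ :=
  Finsupp.onFinset (Finset.range k) (fun i => if h : i < k then (y ⟨i, h⟩ : ℕ) else 0)
    (by intro i hi; by_contra hc; simp_all)

lemma digitsFinsupp_of_lt {M : ℕ → ℕ} {k : ℕ} (y : ∀ i : Fin k, Fin (M i)) {i : ℕ}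
    (h : i < k) : digitsFinsupp y i = y ⟨i, h⟩ := by
  simp [digitsFinsupp, h]

lemma digitsFinsupp_of_le {M : ℕ → ℕ} {k : ℕ} (y : ∀ i : Fin k, Fin (M i)) {i : ℕ}
    (h : k ≤ i) : digitsFinsupp y i = 0 := by
  simp [digitsFinsupp, h]

/-- A sum of products over digit strings with restricted digits factors. -/
lemma sum_digits_ite_prod {R : Type*} [CommRing R] (M L : ℕ → ℕ) (hL : ∀ i, L i ≤ M i) (k : ℕ)
    (g : ℕ → ℕ → R) :
    ∑ y : (∀ i : Fin k, Fin (M i)),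
        (if ∀ i : Fin k, (y i : ℕ) < L i then ∏ i : Fin k, g i (y i) else 0) =
      ∏ i ∈ Finset.range k, ∑ j ∈ Finset.range (L i), g i j := by
  have hfactor : ∀ y : (∀ i : Fin k, Fin (M i)),
      (if ∀ i : Fin k, (y i : ℕ) < L i then ∏ i : Fin k, g i (y i) else 0) =
        ∏ i : Fin k, if (y i : ℕ) < L i then g i (y i) else 0 := by
    intro y
    split_ifs with h
    · exact Finset.prod_congr rfl fun i _ => (if_pos (h i)).symm
    · push Not at h
      obtain ⟨i, hi⟩ := h
      exact (Finset.prod_eq_zero (Finset.mem_univ i) (if_neg (not_lt.mpr hi))).symm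
  rw [Finset.sum_congr rfl fun y _ => hfactor y, ← Fin.prod_univ_eq_prod_range
    (fun i => ∑ j ∈ Finset.range (L i), g i j)]
  rw [← Fintype.piFinset_univ, ← Finset.prod_univ_sum (fun i : Fin k => Finset.univ)
    (fun i (j : Fin (M i)) => if (j : ℕ) < L i then g i j else 0)]
  refine Finset.prod_congr rfl fun i _ => ?_
  rw [Fin.sum_univ_eq_sum_range (fun j => if j < L i then g i j else 0), ← Finset.sum_filter]
  refine Finset.sum_congr ?_ fun _ _ => rfl
  ext j
  have := hL i
  simp only [Finset.mem_filter, Finset.mem_range]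
  omega

end MixedRadix

section Character

/-- The product of the mod `3` sign `1, -1, -1` along a three term progression. -/
lemma sign_mod_three_progression (ψ : ℤ → ℝ) (hψ : ∀ n : ℤ, ψ n = if n % 3 = 0 then 1 else -1)
    (s t : ℤ) : ψ s * ψ (s + t) * ψ (s + t + t) = if t % 3 = 0 then ψ s else 1 := by
  have hs : s % 3 = 0 ∨ s % 3 = 1 ∨ s % 3 = 2 := by omega
  have ht : t % 3 = 0 ∨ t % 3 = 1 ∨ t % 3 = 2 := by omega
  rw [hψ, hψ, hψ]
  rcases hs with hs | hs | hs <;> rcases ht with ht | ht | ht <;>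
    norm_num [Int.add_emod, hs, ht]

/-- A primitive cube root of unity. -/
noncomputable def cubeRoot : ℂ := ⟨-1 / 2, √3 / 2⟩

lemma cubeRoot_sum : 1 + cubeRoot + cubeRoot ^ 2 = 0 := by
  have h : √3 * √3 = 3 := Real.mul_self_sqrt (by norm_num)
  apply Complex.ext
  · simp [cubeRoot, pow_two]; nlinarith
  · simp [cubeRoot, pow_two]; ring

lemma cubeRoot_pow_three : cubeRoot ^ 3 = 1 := by
  linear_combination (cubeRoot - 1) * cubeRoot_sum

lemma cubeRoot_ne_one : cubeRoot ≠ 1 := by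
  intro h
  have := cubeRoot_sum
  rw [h] at this
  norm_num at this

lemma sum_range_cubeRoot_pow {n : ℕ} (hn : 3 ∣ n) :
    ∑ j ∈ Finset.range n, cubeRoot ^ j = 0 := by
  obtain ⟨m, rfl⟩ := hn
  rw [geom_sum_eq cubeRoot_ne_one, pow_mul, cubeRoot_pow_three]
  simp

lemma sign_mod_three_eq_re (n : ℕ) :
    (if (n : ℤ) % 3 = 0 then (1 : ℝ) else -1) = -1 / 3 + 4 / 3 * (cubeRoot ^ n).re := by
  have hsq : cubeRoot ^ 2 = -1 - cubeRoot := by linear_combination cubeRoot_sum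
  have hred : cubeRoot ^ n = cubeRoot ^ (n % 3) := by
    conv_lhs => rw [← Nat.div_add_mod n 3, pow_add, pow_mul, cubeRoot_pow_three, one_pow, one_mul]
  rw [hred]
  have hlt : n % 3 < 3 := Nat.mod_lt _ (by norm_num)
  split_ifs with h
  · have h0 : n % 3 = 0 := by omega
    rw [h0]; norm_num
  · have h12 : n % 3 = 1 ∨ n % 3 = 2 := by omega
    rcases h12 with h1 | h2
    · rw [h1]; norm_num [cubeRoot]
    · rw [h2, hsq]; norm_num [cubeRoot]

/-- If the digits have ranges divisible by `3` and at least one digit `c` occurs in the sum, then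
the mod `3` sign of the sum has mean `-1/3`. -/
lemma sum_digits_ite_sign (M L : ℕ → ℕ) (hL : ∀ i, L i ≤ M i) (hL3 : ∀ i, 3 ∣ L i) (k : ℕ)
    (T : ℕ → Prop) [DecidablePred T] (c : ℕ) (hck : c < k) (hc : T c) :
    ∑ y : (∀ i : Fin k, Fin (M i)),
        (if ∀ i : Fin k, (y i : ℕ) < L i then
          (if ((∑ i : Fin k, if T i then (y i : ℕ) else 0 : ℕ) : ℤ) % 3 = 0 then (1 : ℝ) else -1)
          else 0) =
      (-1 / 3) * ∏ i ∈ Finset.range k, (L i : ℝ) := by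
  have hone := sum_digits_ite_prod M L hL k (fun _ _ => (1 : ℝ))
  have hchar := sum_digits_ite_prod M L hL k (fun i j => cubeRoot ^ (if T i then j else 0))
  rw [Finset.prod_eq_zero (Finset.mem_range.mpr hck)
    (by simpa [hc] using sum_range_cubeRoot_pow (hL3 c))] at hchar
  have hre := congrArg Complex.re hchar
  simp only [Complex.re_sum, Complex.zero_re] at hre
  simp only [Finset.prod_const_one, Finset.sum_const, Finset.card_range, nsmul_eq_mul,
    mul_one] at hone
  refine Eq.trans ?_ (add_zero _)
  refine Eq.trans ?_ (congrArg _ (mul_zero (4 / 3 : ℝ)))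
  refine Eq.trans ?_ (congrArg (fun t => _ + 4 / 3 * t) hre)
  rw [← hone, Finset.mul_sum, Finset.mul_sum, ← Finset.sum_add_distrib]
  refine Finset.sum_congr rfl fun y _ => ?_
  by_cases h : ∀ i : Fin k, (y i : ℕ) < L i
  · rw [if_pos h, if_pos h, if_pos h, Finset.prod_pow_eq_pow_sum, sign_mod_three_eq_re, mul_one]
  · rw [if_neg h, if_neg h, if_neg h, Complex.zero_re]
    ring

end Character

section Pairs

lemma single_add_single_eq_zero_iff {p q i : ℕ} :
    (Finsupp.single p 1 + Finsupp.single q 1 : ℕ →₀ ℕ) i = 0 ↔ i ≠ p ∧ i ≠ q := by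
  simp [Finsupp.single_apply, eq_comm]

/-- For pairs `z` and `w`, the sum of `w` off the support of `z` is divisible by `3` only when
`z = w`. -/
lemma sum_pair_off_support_mod_three {k a b : ℕ} (hab : a < b) (hbk : b < k) {z : ℕ →₀ ℕ}
    (hz : ∃ p q : ℕ, p < q ∧ q < k ∧ z = Finsupp.single p 1 + Finsupp.single q 1) :
    (∑ i ∈ (Finset.range k).filter (fun i => z i = 0),
      (((Finsupp.single a 1 + Finsupp.single b 1 : ℕ →₀ ℕ) i : ℕ) : ℤ)) % 3 = 0 ↔
      z = Finsupp.single a 1 + Finsupp.single b 1 := by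
  obtain ⟨p, q, hpq, hqk, rfl⟩ := hz
  have hak : a < k := hab.trans hbk
  have hsum : (∑ i ∈ (Finset.range k).filter
      (fun i => (Finsupp.single p 1 + Finsupp.single q 1 : ℕ →₀ ℕ) i = 0),
      (((Finsupp.single a 1 + Finsupp.single b 1 : ℕ →₀ ℕ) i : ℕ) : ℤ)) =
      (if a ≠ p ∧ a ≠ q then 1 else 0) + (if b ≠ p ∧ b ≠ q then 1 else 0) := by
    simp only [single_add_single_eq_zero_iff]
    simp [Finsupp.single_apply, Finset.sum_add_distrib, hak, hbk]
  rw [hsum]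
  constructor
  · intro h
    have hpa : p = a ∧ q = b := by split_ifs at h <;> omega
    rw [hpa.1, hpa.2]
  · intro h
    have ha := (single_add_single_eq_zero_iff (p := p) (q := q) (i := a)).not
    have hb := (single_add_single_eq_zero_iff (p := p) (q := q) (i := b)).not
    rw [h, single_add_single_eq_zero_iff] at ha hb
    simp only [ne_eq, not_true_eq_false, false_and, and_false, not_false_eq_true, true_iff] at ha hb
    rw [if_neg ha, if_neg hb]
    rfl

lemma finite_pairs (k : ℕ) : {z : ℕ →₀ ℕ | ∃ a b : ℕ, a < b ∧ b < k ∧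
    z = Finsupp.single a 1 + Finsupp.single b 1}.Finite := by
  refine ((Finset.range k ×ˢ Finset.range k).image
    fun p : ℕ × ℕ => (Finsupp.single p.1 1 + Finsupp.single p.2 1 : ℕ →₀ ℕ)).finite_toSet.subset ?_
  rintro z ⟨a, b, hab, hbk, rfl⟩
  simp only [Finset.coe_image, Set.mem_image, Finset.mem_coe, Finset.mem_product, Finset.mem_range]
  exact ⟨(a, b), ⟨hab.trans hbk, hbk⟩, rfl⟩

end Pairs

/-- Lemma 4.1 of the paper: for every `d ∈ 𝒮`, `lim_{k → ∞} S_k(d) = γ · η(d)`.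
Everything is 0-indexed: `M i` stands for `M_{i+1}`, `N k = M_1 ⋯ M_k`. -/
theorem stmt_6 (M : ℕ → ℕ) (hmono : StrictMono M) (hpos : ∀ i, 0 < M i)
    (hdiv : ∀ i, 3 ∣ M i)
    (hlog : Tendsto (fun k : ℕ => (∑ i ∈ Finset.range k, Real.log (M i)) / (k : ℝ) ^ 2)
      atTop (nhds 0))
    (γ : ℝ) (hγ : 0 < γ)
    (hprod : Tendsto (fun k : ℕ => ∏ i ∈ Finset.range k, (1 - 3 / (M i : ℝ)))
      atTop (nhds γ))
    (N : ℕ → ℕ) (hN : ∀ k, N k = ∏ i ∈ Finset.range k, M i)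
    (Ω Ωt Sig : ℕ → Set (ℕ →₀ ℕ))
    (hΩ : ∀ k, Ω k = {x | (∀ i, x i < M i) ∧ ∀ i, k ≤ i → x i = 0})
    (hΩt : ∀ k, Ωt k = {x | (∀ i, i < k → x i < M i - 3) ∧ ∀ i, k ≤ i → x i = 0})
    (hSig : ∀ k, Sig k = {z | ∃ a b : ℕ, a < b ∧ b < k ∧
      z = Finsupp.single a 1 + Finsupp.single b 1})
    (β : (ℕ →₀ ℕ) → ℕ) (hβ : ∀ x, β x = ∑ i ∈ x.support, N i * x i)
    (S : Set ℕ) (hS : S = {n | ∃ a b : ℕ, a < b ∧ n = N a + N b})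
    (ψ : ℤ → ℝ) (hψ : ∀ n : ℤ, ψ n = if n % 3 = 0 then 1 else -1)
    (η : ℕ → ℝ) (hη : ∀ n ∈ S, η n = 1 ∨ η n = -1/3)
    (Sigm : ℕ → Set (ℕ →₀ ℕ)) (hSigm : ∀ k, Sigm k = {z ∈ Sig k | η (β z) = -1/3})
    (σ : ℕ → (ℕ →₀ ℕ) → (ℕ →₀ ℕ) → ℤ)
    (hσ : ∀ k z x, σ k z x =
      ∑ i ∈ (Finset.range k).filter (fun i => z i = 0), (x i : ℤ))
    (f ft : ℕ → ℕ → ℝ)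
    (hf : ∀ k, ∀ x ∈ Ω k, f k (β x) = ∏ᶠ z ∈ Sigm k, ψ (σ k z x))
    (hf0 : ∀ k n, N k ≤ n → f k n = 0)
    (hft1 : ∀ k, ∀ x ∈ Ωt k, ft k (β x) = f k (β x))
    (hft2 : ∀ k, ∀ x ∈ Ω k \ Ωt k, ft k (β x) = 0)
    (hft0 : ∀ k n, N k ≤ n → ft k n = 0)
    (Sk : ℕ → ℕ → ℝ)
    (hSk : ∀ k d, Sk k d =
      (∑ n ∈ Finset.range (N k), ft k n * f k (n + d) * f k (n + 2 * d)) / (N k : ℝ)) :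
    ∀ d ∈ S, Tendsto (fun k : ℕ => Sk k d) atTop (nhds (γ * η d)) := by
  intro d hd
  obtain ⟨a, b, hab, rfl⟩ : ∃ a b : ℕ, a < b ∧ d = N a + N b := by simpa [hS] using hd
  have hM3 : ∀ i, 3 ≤ M i := fun i => Nat.le_of_dvd (hpos i) (hdiv i)
  set w : ℕ →₀ ℕ := Finsupp.single a 1 + Finsupp.single b 1 with hw
  have hβsum : ∀ x, β x = x.sum fun i v => N i * v := fun x => hβ x
  have hβadd : ∀ x y, β (x + y) = β x + β y := fun x y => by
    simp only [hβsum]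
    exact Finsupp.sum_add_index' (by simp) (by intros; ring)
  have hβw : β w = N a + N b := by
    rw [hw, hβadd, hβsum, hβsum]; simp
  have hwle : ∀ i, w i ≤ 1 := fun i => by
    simp only [hw, Finsupp.add_apply, Finsupp.single_apply]
    split_ifs <;> omega
  have hw0 : ∀ k i, b < k → k ≤ i → w i = 0 := fun k i hbk hki =>
    single_add_single_eq_zero_iff.mpr ⟨by omega, by omega⟩
  have hσadd : ∀ k z x y, σ k z (x + y) = σ k z x + σ k z y := fun k z x y => by
    simp only [hσ, Finsupp.add_apply, Nat.cast_add, Finset.sum_add_distrib]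
  have hfin : ∀ k, (Sigm k).Finite := fun k => by
    rw [hSigm, hSig]; exact (finite_pairs k).subset (Set.sep_subset _ _)
  have htriple : ∀ k x, b < k → x ∈ Ωt k → ft k (β x) * f k (β x + (N a + N b)) *
      f k (β x + 2 * (N a + N b)) = if η (N a + N b) = -1 / 3 then ψ (σ k w x) else 1 := by
    intro k x hbk hx
    have hx' := hx
    rw [hΩt] at hx'
    obtain ⟨hxlt, hxzero⟩ := hx'
    have hmem : ∀ u : ℕ →₀ ℕ, (∀ i, u i ≤ 2) → (∀ i, k ≤ i → u i = 0) → x + u ∈ Ω k := by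
      intro u hu hu0
      rw [hΩ]
      refine ⟨fun i => ?_, fun i hi => by simp [hxzero i hi, hu0 i hi]⟩
      have h3 := hM3 i
      have h2 := hu i
      rcases lt_or_ge i k with hi | hi
      · have := hxlt i hi
        simp only [Finsupp.add_apply]; omega
      · simp only [Finsupp.add_apply, hxzero i hi, hu0 i hi]; omega
    have h0 : x ∈ Ω k := by simpa using hmem 0 (by simp) (by simp)
    have h1 : x + w ∈ Ω k := hmem w (fun i => (hwle i).trans (by norm_num))
      fun i hi => hw0 k i hbk hi
    have h2 : x + w + w ∈ Ω k := by
      rw [add_assoc]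
      refine hmem (w + w) (fun i => ?_) fun i hi => by simp [hw0 k i hbk hi]
      have := hwle i
      simp only [Finsupp.add_apply]; omega
    have e1 : β x + (N a + N b) = β (x + w) := by rw [hβadd, hβw]
    have e2 : β x + 2 * (N a + N b) = β (x + w + w) := by rw [hβadd, hβadd, hβw]; ring
    rw [hft1 k x hx, e1, e2, hf k _ h0, hf k _ h1, hf k _ h2,
      ← finprod_mem_mul_distrib (hfin k), ← finprod_mem_mul_distrib (hfin k)]
    simp only [hσadd, sign_mod_three_progression ψ hψ]
    have hz : ∀ z ∈ Sigm k, (if σ k z w % 3 = 0 then ψ (σ k z x) else 1) =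
        if z = w then ψ (σ k w x) else 1 := by
      intro z hzm
      rw [hSigm, hSig] at hzm
      have hiff : σ k z w % 3 = 0 ↔ z = w := by
        rw [hσ]; exact sum_pair_off_support_mod_three hab hbk hzm.1
      by_cases hzw : z = w
      · rw [if_pos (hiff.mpr hzw), if_pos hzw, hzw]
      · rw [if_neg (mt hiff.mp hzw), if_neg hzw]
    rw [finprod_mem_congr rfl hz, finprod_mem_eq_finite_toFinset_prod _ (hfin k),
      Finset.prod_ite_eq']
    have hwm : w ∈ Sigm k ↔ η (N a + N b) = -1 / 3 := by
      rw [hSigm, hSig, ← hβw]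
      exact ⟨fun h => h.2, fun h => ⟨⟨a, b, hab, hbk, rfl⟩, h⟩⟩
    simp only [Set.Finite.mem_toFinset, hwm]
  have hsumdig : ∀ k, b < k → ∑ n ∈ Finset.range (N k),
      ft k n * f k (n + (N a + N b)) * f k (n + 2 * (N a + N b)) =
      ∑ y : (∀ i : Fin k, Fin (M i)), if ∀ i : Fin k, (y i : ℕ) < M i - 3 then
        (if η (N a + N b) = -1 / 3 then ψ (σ k w (digitsFinsupp y)) else 1) else 0 := by
    intro k hbk
    rw [hN k, sum_range_prod_eq_sum_digits]
    refine Finset.sum_congr rfl fun y _ => ?_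
    have hβy : ∑ i : Fin k, (∏ j ∈ Finset.range i, M j) * (y i : ℕ) =
        β (digitsFinsupp y) := by
      have hsupp : (digitsFinsupp y).support ⊆ Finset.range k := Finsupp.support_onFinset_subset
      rw [hβsum, Finsupp.sum_of_support_subset _ hsupp _ (by simp), Finset.sum_range]
      refine Finset.sum_congr rfl fun i _ => ?_
      rw [digitsFinsupp_of_lt y i.2, hN]
    rw [hβy]
    have hyt : digitsFinsupp y ∈ Ωt k ↔ ∀ i : Fin k, (y i : ℕ) < M i - 3 := by
      rw [hΩt]
      refine ⟨fun h i => ?_, fun h => ⟨fun i hi => ?_, fun i hi => digitsFinsupp_of_le y hi⟩⟩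
      · simpa [digitsFinsupp_of_lt y i.2] using h.1 i i.2
      · simpa [digitsFinsupp_of_lt y hi] using h ⟨i, hi⟩
    have hyΩ : digitsFinsupp y ∈ Ω k := by
      rw [hΩ]
      refine ⟨fun i => ?_, fun i hi => digitsFinsupp_of_le y hi⟩
      rcases lt_or_ge i k with hi | hi
      · rw [digitsFinsupp_of_lt y hi]; exact (y ⟨i, hi⟩).2
      · rw [digitsFinsupp_of_le y hi]; exact hpos i
    by_cases h : ∀ i : Fin k, (y i : ℕ) < M i - 3
    · rw [if_pos h]; exact htriple k _ hbk (hyt.mpr h)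
    · rw [if_neg h, hft2 k _ ⟨hyΩ, mt hyt.mp h⟩, zero_mul, zero_mul]
  have hvalue : ∀ k, b + 2 ≤ k → ∑ n ∈ Finset.range (N k),
      ft k n * f k (n + (N a + N b)) * f k (n + 2 * (N a + N b)) =
      η (N a + N b) * ∏ i ∈ Finset.range k, ((M i - 3 : ℕ) : ℝ) := by
    intro k hk
    rw [hsumdig k (by omega)]
    rcases hη _ hd with h1 | h3
    · have hone := sum_digits_ite_prod M (fun i => M i - 3) (fun i => Nat.sub_le _ _) k
        (fun _ _ => (1 : ℝ))
      simp only [Finset.prod_const_one, Finset.sum_const, Finset.card_range, nsmul_eq_mul,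
        mul_one] at hone
      have hne : ¬ ((1 : ℝ) = -1 / 3) := by norm_num
      rw [h1, one_mul, ← hone]
      simp only [if_neg hne]
    · simp only [h3, if_true]
      rw [← sum_digits_ite_sign M (fun i => M i - 3) (fun i => Nat.sub_le _ _)
        (fun i => Nat.dvd_sub (hdiv i) dvd_rfl) k (fun i => w i = 0) (b + 1) (by omega)
        (hw0 (b + 1) (b + 1) (by omega) le_rfl)]
      refine Finset.sum_congr rfl fun y _ => ?_
      rw [hψ, hσ, Finset.sum_filter, Finset.sum_range]
      push_cast
      simp only [digitsFinsupp_of_lt y (Fin.is_lt _)]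
  refine Tendsto.congr' ?_ (mul_comm γ _ ▸ hprod.const_mul (η (N a + N b)))
  filter_upwards [eventually_ge_atTop (b + 2)] with k hk
  rw [hSk, hvalue k hk, hN k, mul_div_assoc, Nat.cast_prod, ← Finset.prod_div_distrib]
  congr 1
  refine Finset.prod_congr rfl fun i _ => ?_
  have : (M i : ℝ) ≠ 0 := Nat.cast_ne_zero.mpr (hpos i).ne'
  rw [Nat.cast_sub (hM3 i), sub_div, div_self this]
  norm_num
end

section
/- Let 𝒮 ⊆ ℕ be an infinite set with lim_{N→∞} |𝒮[N]| / log N = ∞, where 𝒮[N] := {n ∈ 𝒮 : n ≤ N}. For each C ∈ ℕ let F_C be a set of functions a : ℕ → ℂ with |a(n)| ≤ 1 for all n, and suppose there is a function M : ℕ × (0,1) → (0,∞) such that for every C ∈ ℕ, every ε ∈ (0,1) and every integer N ≥ 2, the set of restrictions {(a(1), …, a(N)) : a ∈ F_C} ⊆ ℂ^N can be covered by at most N^{M(C,ε)} closed balls of radius ε in the supremum norm on ℂ^N. Then there exists a function η : 𝒮 → {1, −1/3} such that for every a ∈ ⋃_{C ∈ ℕ} F_C one has lim_{N→∞} (1/|𝒮[N]|)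 ∑_{n ∈ 𝒮[N]} η(n) a(n) = 0. -/
open Filter

open MeasureTheory ProbabilityTheory

section RandomSigns

variable {Ω : Type*} [MeasurableSpace Ω] {μ : Measure Ω} [IsProbabilityMeasure μ] {X : ℕ → Ω → ℝ}

/-- Hoeffding's inequality for weighted sums of independent centred variables bounded by `1`. -/
lemma measureReal_le_weighted_sum (hind : iIndepFun X μ) (hmeas : ∀ n, Measurable (X n))
    (hX : ∀ n ω, |X n ω| ≤ 1) (hmean : ∀ n, ∫ ω, X n ω ∂μ = 0) (s : Finset ℕ) {r : ℕ → ℝ}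
    (hr : ∀ n, |r n| ≤ 1) {t : ℝ} (ht : 0 ≤ t) :
    μ.real {ω | t * s.card ≤ ∑ n ∈ s, r n * X n ω} ≤ Real.exp (-(t ^ 2 * s.card / 2)) := by
  have hind' : iIndepFun (fun n ω => r n * X n ω) μ :=
    hind.comp (fun n x => r n * x) fun n => by fun_prop
  have hsub : ∀ n ∈ s, HasSubgaussianMGF (fun ω => r n * X n ω) 1 μ := by
    intro n _
    have h := hasSubgaussianMGF_of_mem_Icc_of_integral_eq_zero (μ := μ) (a := -1) (b := 1)
      (X := fun ω => r n * X n ω) ((hmeas n).const_mul _).aemeasurable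
      (ae_of_all _ fun ω => by
        rw [Set.mem_Icc, ← abs_le, abs_mul]
        exact mul_le_one₀ (hr n) (abs_nonneg _) (hX n ω))
      (by rw [integral_const_mul, hmean, mul_zero])
    convert h using 1
    ext
    norm_num
  refine (HasSubgaussianMGF.measure_sum_ge_le_of_iIndepFun hind' hsub
    (mul_nonneg ht (Nat.cast_nonneg _))).trans (le_of_eq ?_)
  congr 1
  rcases Nat.eq_zero_or_pos s.card with h | h
  · simp [h]
  · have : (s.card : ℝ) ≠ 0 := by positivity
    simp only [Finset.sum_const, nsmul_eq_mul, mul_one, NNReal.coe_natCast]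
    field_simp

lemma measureReal_lt_norm_weighted_sum (hind : iIndepFun X μ) (hmeas : ∀ n, Measurable (X n))
    (hX : ∀ n ω, |X n ω| ≤ 1) (hmean : ∀ n, ∫ ω, X n ω ∂μ = 0) (s : Finset ℕ) {c : ℕ → ℂ}
    (hc : ∀ n, ‖c n‖ ≤ 1) {t : ℝ} (ht : 0 ≤ t) :
    μ.real {ω | 2 * t * s.card < ‖∑ n ∈ s, (X n ω : ℂ) * c n‖} ≤
      4 * Real.exp (-(t ^ 2 * s.card / 2)) := by
  have key := fun (r : ℕ → ℝ) (hr : ∀ n, |r n| ≤ 1) =>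
    measureReal_le_weighted_sum hind hmeas hX hmean s hr ht
  have hre : ∀ n, |(c n).re| ≤ 1 := fun n => (Complex.abs_re_le_norm _).trans (hc n)
  have him : ∀ n, |(c n).im| ≤ 1 := fun n => (Complex.abs_im_le_norm _).trans (hc n)
  have h₁ := key (fun n => (c n).re) hre
  have h₂ := key (fun n => -(c n).re) (by simpa using hre)
  have h₃ := key (fun n => (c n).im) him
  have h₄ := key (fun n => -(c n).im) (by simpa using him)
  have hsub : {ω | 2 * t * s.card < ‖∑ n ∈ s, (X n ω : ℂ) * c n‖} ⊆
      ({ω | t * s.card ≤ ∑ n ∈ s, (c n).re * X n ω} ∪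
        {ω | t * s.card ≤ ∑ n ∈ s, -(c n).re * X n ω}) ∪
      ({ω | t * s.card ≤ ∑ n ∈ s, (c n).im * X n ω} ∪
        {ω | t * s.card ≤ ∑ n ∈ s, -(c n).im * X n ω}) := by
    intro ω hω
    simp only [Set.mem_ofPred_eq, Set.mem_union, neg_mul, Finset.sum_neg_distrib] at hω ⊢
    have h := hω.trans_le (Complex.norm_le_abs_re_add_abs_im _)
    simp only [Complex.re_sum, Complex.im_sum, Complex.re_ofReal_mul, Complex.im_ofReal_mul] at h
    simp only [mul_comm (X _ ω)] at h
    by_contra! hcon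
    have h₅ := abs_lt.2 ⟨neg_lt.1 hcon.1.2, hcon.1.1⟩
    have h₆ := abs_lt.2 ⟨neg_lt.1 hcon.2.2, hcon.2.1⟩
    linarith
  have hm := measureReal_mono (μ := μ) hsub
  refine hm.trans ((measureReal_union_le _ _).trans ?_)
  have h₅ := measureReal_union_le (μ := μ) {ω | t * s.card ≤ ∑ n ∈ s, (c n).re * X n ω}
    {ω | t * s.card ≤ ∑ n ∈ s, -(c n).re * X n ω}
  have h₆ := measureReal_union_le (μ := μ) {ω | t * s.card ≤ ∑ n ∈ s, (c n).im * X n ω}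
    {ω | t * s.card ≤ ∑ n ∈ s, -(c n).im * X n ω}
  linarith

/-- If `s N` grows faster than `log N`, then almost surely the random sums over `s N` against
polynomially many bounded weights are eventually uniformly small. -/
lemma ae_eventually_forall_norm_weighted_sum_le (hind : iIndepFun X μ)
    (hmeas : ∀ n, Measurable (X n)) (hX : ∀ n ω, |X n ω| ≤ 1)
    (hmean : ∀ n, ∫ ω, X n ω ∂μ = 0) (s : ℕ → Finset ℕ)
    (hs : Tendsto (fun N : ℕ => ((s N).card : ℝ) / Real.log N) atTop atTop)
    (G : ℕ → Finset (ℕ → ℂ)) (hG : ∀ N, ∀ c ∈ G N, ∀ n, ‖c n‖ ≤ 1) (m : ℝ)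
    (hcard : ∀ N, 2 ≤ N → ((G N).card : ℝ) ≤ (N : ℝ) ^ m) {t : ℝ} (ht : 0 < t) :
    ∀ᵐ ω ∂μ, ∀ᶠ N in atTop, ∀ c ∈ G N,
      ‖∑ n ∈ s N, (X n ω : ℂ) * c n‖ ≤ 2 * t * (s N).card := by
  let bad : ℕ → Set Ω := fun N =>
    ⋃ c ∈ G N, {ω | 2 * t * (s N).card < ‖∑ n ∈ s N, (X n ω : ℂ) * c n‖}
  have hev : ∀ᶠ N in atTop, μ.real (bad N) ≤ 4 * (1 / (N : ℝ) ^ 2) := by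
    filter_upwards [hs.eventually_ge_atTop ((m + 2) * 2 / t ^ 2), eventually_ge_atTop 2]
      with N hN h2
    have hN1 : (1 : ℝ) < N := by exact_mod_cast h2
    have hlog : 0 < Real.log N := Real.log_pos hN1
    have hlow : (m + 2) * Real.log N ≤ t ^ 2 * (s N).card / 2 := by
      rw [div_le_div_iff₀ (by positivity) hlog] at hN
      linarith
    calc μ.real (bad N)
        ≤ ∑ c ∈ G N, μ.real {ω | 2 * t * (s N).card < ‖∑ n ∈ s N, (X n ω : ℂ) * c n‖} :=
          measureReal_biUnion_finset_le _ _
      _ ≤ ∑ c ∈ G N, 4 * Real.exp (-(t ^ 2 * (s N).card / 2)) :=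
          Finset.sum_le_sum fun c hc =>
            measureReal_lt_norm_weighted_sum hind hmeas hX hmean (s N) (hG N c hc) ht.le
      _ = (G N).card * (4 * Real.exp (-(t ^ 2 * (s N).card / 2))) := by simp
      _ ≤ (N : ℝ) ^ m * (4 * Real.exp (-((m + 2) * Real.log N))) := by
          gcongr
          exact hcard N h2
      _ = 4 * (1 / (N : ℝ) ^ 2) := by
          have hN0 : (0 : ℝ) < N := by linarith
          rw [Real.rpow_def_of_pos hN0, mul_left_comm, ← Real.exp_add,
            show Real.log N * m + -((m + 2) * Real.log N) = -((2 : ℕ) * Real.log N) by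
              push_cast; ring, Real.exp_neg, Real.exp_nat_mul, Real.exp_log hN0, one_div]
  obtain ⟨N₀, hN₀⟩ := eventually_atTop.1 hev
  have hsum : ∑' N, μ (if N₀ ≤ N then bad N else ∅) ≠ ⊤ := by
    have hsm : Summable fun N : ℕ => 4 * (1 / (N : ℝ) ^ 2) :=
      (Real.summable_one_div_nat_pow.2 one_lt_two).mul_left 4
    refine ne_top_of_le_ne_top hsm.tsum_ofReal_ne_top (ENNReal.tsum_le_tsum fun N => ?_)
    split_ifs with h
    · rw [← ofReal_measureReal (measure_ne_top _ _)]
      exact ENNReal.ofReal_le_ofReal (hN₀ N h)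
    · simp
  filter_upwards [ae_eventually_notMem hsum] with ω hω
  filter_upwards [hω, eventually_ge_atTop N₀] with N hN h c hc
  rw [if_pos h] at hN
  by_contra! hlt
  exact hN (Set.mem_biUnion hc hlt)

end RandomSigns

/-- The distribution on `Bool` giving mass `1/4` to `true`. -/
noncomputable def quarterBernoulli : Measure Bool :=
  ENNReal.ofReal (1 / 4) • Measure.dirac true + ENNReal.ofReal (3 / 4) • Measure.dirac false

instance : IsProbabilityMeasure quarterBernoulli where
  measure_univ := by
    simp only [quarterBernoulli, Measure.add_apply, Measure.smul_apply, measure_univ, smul_eq_mul,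
      mul_one]
    rw [← ENNReal.ofReal_add (by norm_num) (by norm_num)]
    norm_num

/-- The two-point map onto `{1, -1/3}`. -/
noncomputable def skewSign (b : Bool) : ℝ := if b then 1 else -1 / 3

lemma skewSign_eq (b : Bool) : skewSign b = 1 ∨ skewSign b = -1 / 3 := by
  cases b <;> simp [skewSign]

lemma abs_skewSign_le (b : Bool) : |skewSign b| ≤ 1 := by
  rcases skewSign_eq b with h | h <;> rw [h] <;> norm_num [abs_le]

lemma integral_skewSign : ∫ b, skewSign b ∂quarterBernoulli = 0 := by
  rw [quarterBernoulli, integral_add_measure (Integrable.of_finite.smul_measure ENNReal.ofReal_ne_top)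
      (Integrable.of_finite.smul_measure ENNReal.ofReal_ne_top), integral_smul_measure,
    integral_smul_measure, integral_dirac, integral_dirac]
  norm_num [skewSign]

/-- An external net can be replaced by a bounded one at the cost of doubling the radius. -/
lemma exists_bounded_net {F : Set (ℕ → ℂ)} (hF : ∀ a ∈ F, ∀ n, ‖a n‖ ≤ 1) {ε : ℝ} {N : ℕ}
    (T : Finset (ℕ → ℂ))
    (hT : ∀ a ∈ F, ∃ c ∈ T, ∀ n : ℕ, 1 ≤ n → n ≤ N → ‖a n - c n‖ ≤ ε) :
    ∃ G : Finset (ℕ → ℂ), G.card ≤ T.card ∧ (∀ c ∈ G, ∀ n, ‖c n‖ ≤ 1) ∧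
      ∀ a ∈ F, ∃ c ∈ G, ∀ n : ℕ, 1 ≤ n → n ≤ N → ‖a n - c n‖ ≤ 2 * ε := by
  classical
  have hrep : ∀ c : ℕ → ℂ, ∃ b : ℕ → ℂ, (∀ n, ‖b n‖ ≤ 1) ∧
      ((∃ a ∈ F, ∀ n : ℕ, 1 ≤ n → n ≤ N → ‖a n - c n‖ ≤ ε) →
        ∀ n : ℕ, 1 ≤ n → n ≤ N → ‖b n - c n‖ ≤ ε) := by
    intro c
    by_cases h : ∃ a ∈ F, ∀ n : ℕ, 1 ≤ n → n ≤ N → ‖a n - c n‖ ≤ ε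
    · obtain ⟨a, ha, hac⟩ := h
      exact ⟨a, hF a ha, fun _ => hac⟩
    · exact ⟨0, by simp, fun h' => absurd h' h⟩
  choose b hb1 hb2 using hrep
  refine ⟨T.image b, Finset.card_image_le, ?_, fun a ha => ?_⟩
  · intro c hc
    obtain ⟨d, -, rfl⟩ := Finset.mem_image.1 hc
    exact hb1 d
  · obtain ⟨c, hc, hac⟩ := hT a ha
    refine ⟨b c, Finset.mem_image_of_mem b hc, fun n h1 hN => ?_⟩
    have h := hb2 c ⟨a, ha, hac⟩ n h1 hN
    calc ‖a n - b c n‖ = ‖(a n - c n) - (b c n - c n)‖ := by congr 1; ring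
      _ ≤ ‖a n - c n‖ + ‖b c n - c n‖ := norm_sub_le _ _
      _ ≤ 2 * ε := by linarith [hac n h1 hN]

/-- Replacing the weights by close ones changes a bounded-sign sum little; the index `0`, where no
closeness is assumed, contributes at most `2`. -/
lemma norm_sum_le_of_close {N : ℕ} {s : Finset ℕ} (hs : ∀ n ∈ s, n ≤ N) {x : ℕ → ℝ}
    (hx : ∀ n, |x n| ≤ 1) {a c : ℕ → ℂ} (ha : ∀ n, ‖a n‖ ≤ 1) (hc : ∀ n, ‖c n‖ ≤ 1) {δ : ℝ}
    (hδ : 0 ≤ δ) (hac : ∀ n : ℕ, 1 ≤ n → n ≤ N → ‖a n - c n‖ ≤ δ) :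
    ‖∑ n ∈ s, (x n : ℂ) * a n‖ ≤ ‖∑ n ∈ s, (x n : ℂ) * c n‖ + (δ * s.card + 2) := by
  have hterm : ∀ n ∈ s, ‖(x n : ℂ) * a n - (x n : ℂ) * c n‖ ≤ δ + if n = 0 then 2 else 0 := by
    intro n hn
    have h1 : ‖(x n : ℂ) * a n - (x n : ℂ) * c n‖ ≤ ‖a n - c n‖ := by
      rw [← mul_sub, norm_mul, Complex.norm_real, Real.norm_eq_abs]
      exact mul_le_of_le_one_left (norm_nonneg _) (hx n)
    refine h1.trans ?_
    split_ifs with h0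
    · linarith [norm_sub_le (a n) (c n), ha n, hc n]
    · linarith [hac n (Nat.one_le_iff_ne_zero.2 h0) (hs n hn)]
  have hdiff : ‖∑ n ∈ s, (x n : ℂ) * a n - ∑ n ∈ s, (x n : ℂ) * c n‖ ≤ δ * s.card + 2 := by
    rw [← Finset.sum_sub_distrib]
    refine (norm_sum_le_of_le s hterm).trans ?_
    rw [Finset.sum_add_distrib, Finset.sum_const, nsmul_eq_mul, Finset.sum_ite_eq', mul_comm]
    gcongr
    split_ifs <;> norm_num
  linarith [norm_le_norm_add_norm_sub' (∑ n ∈ s, (x n : ℂ) * a n) (∑ n ∈ s, (x n : ℂ) * c n)]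

/-- Proposition 3.1 (abstract entropy form): if `𝒮 ⊆ ℕ` is infinite with
`|𝒮[N]| / log N → ∞`, and for each complexity `C` the class `F C` of 1-bounded
functions `ℕ → ℂ` has restrictions to `{1, …, N}` coverable by `N^{M(C,ε)}`
closed `ε`-balls in the sup norm, then there is `η : 𝒮 → {1, −1/3}` with
`(1/|𝒮[N]|) ∑_{n ∈ 𝒮[N]} η(n) a(n) → 0` for every `a ∈ ⋃ C, F C`. -/
theorem stmt_7 (S : Set ℕ) (hinf : S.Infinite)
    (hgrow : Tendsto (fun N : ℕ => (Set.ncard {n ∈ S | n ≤ N} : ℝ) / Real.log N)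
      atTop atTop)
    (F : ℕ → Set (ℕ → ℂ))
    (hbd : ∀ C : ℕ, ∀ a ∈ F C, ∀ n : ℕ, ‖a n‖ ≤ 1)
    (M : ℕ → ℝ → ℝ) (hMpos : ∀ C ε, 0 < M C ε)
    (hcover : ∀ (C : ℕ) (ε : ℝ), ε ∈ Set.Ioo (0 : ℝ) 1 → ∀ N : ℕ, 2 ≤ N →
      ∃ T : Finset (ℕ → ℂ), (T.card : ℝ) ≤ (N : ℝ) ^ (M C ε) ∧
        ∀ a ∈ F C, ∃ c ∈ T, ∀ n : ℕ, 1 ≤ n → n ≤ N → ‖a n - c n‖ ≤ ε) :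
    ∃ η : ℕ → ℝ, (∀ n ∈ S, η n = 1 ∨ η n = -1/3) ∧
      ∀ C : ℕ, ∀ a ∈ F C,
        Tendsto (fun N : ℕ =>
            (∑ᶠ n ∈ {n ∈ S | n ≤ N}, (η n : ℂ) * a n) /
              (Set.ncard {n ∈ S | n ≤ N} : ℂ))
          atTop (nhds 0) := by
  classical
  let s : ℕ → Finset ℕ := fun N => (Finset.range (N + 1)).filter (· ∈ S)
  have hs : ∀ N, {n ∈ S | n ≤ N} = (s N : Set ℕ) := by
    intro N
    ext n
    simp [s, and_comm]
  simp only [hs, Set.ncard_coe_finset, finsum_mem_coe_finset] at hgrow ⊢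
  have hcardS : Tendsto (fun N => ((s N).card : ℝ)) atTop atTop := by
    have hlog : Tendsto (fun N : ℕ => Real.log N) atTop atTop :=
      Real.tendsto_log_atTop.comp tendsto_natCast_atTop_atTop
    refine (hgrow.atTop_mul_atTop₀ hlog).congr' ?_
    filter_upwards [hlog.eventually_gt_atTop 0] with N hN
    exact div_mul_cancel₀ _ hN.ne'
  let ε : ℕ → ℝ := fun k => 1 / ((k : ℝ) + 2)
  have hεpos : ∀ k, 0 < ε k := fun k => by positivity
  have hε1 : ∀ k, ε k < 1 := fun k => by
    rw [div_lt_one (by positivity)]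
    linarith [(Nat.cast_nonneg k : (0 : ℝ) ≤ k)]
  have hnet : ∀ C k N : ℕ, ∃ G : Finset (ℕ → ℂ), (∀ c ∈ G, ∀ n, ‖c n‖ ≤ 1) ∧
      (2 ≤ N → (G.card : ℝ) ≤ (N : ℝ) ^ M C (ε k) ∧
        ∀ a ∈ F C, ∃ c ∈ G, ∀ n : ℕ, 1 ≤ n → n ≤ N → ‖a n - c n‖ ≤ 2 * ε k) := by
    intro C k N
    by_cases h2 : 2 ≤ N
    · obtain ⟨T, hTcard, hT⟩ := hcover C (ε k) ⟨hεpos k, hε1 k⟩ N h2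
      obtain ⟨G, hcard, hG, hFG⟩ := exists_bounded_net (hbd C) T hT
      exact ⟨G, hG, fun _ => ⟨le_trans (by exact_mod_cast hcard) hTcard, hFG⟩⟩
    · exact ⟨∅, by simp, fun h => absurd h h2⟩
  choose G hG1 hG2 using hnet
  let μ : Measure (ℕ → Bool) := Measure.infinitePi fun _ => quarterBernoulli
  have hsign : Measurable skewSign := measurable_of_finite _
  have hind : iIndepFun (fun n (ω : ℕ → Bool) => skewSign (ω n)) μ :=
    iIndepFun_infinitePi fun _ => hsign
  have hmean : ∀ n, ∫ ω, skewSign (ω n) ∂μ = 0 := by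
    intro n
    have hmp : MeasurePreserving (Function.eval n) μ quarterBernoulli :=
      measurePreserving_eval_infinitePi _ n
    rw [← integral_skewSign, ← hmp.map_eq]
    exact (integral_map hmp.measurable.aemeasurable hsign.aestronglyMeasurable).symm
  have hae : ∀ᵐ ω ∂μ, ∀ C k, ∀ᶠ N in atTop, ∀ c ∈ G C k N,
      ‖∑ n ∈ s N, (skewSign (ω n) : ℂ) * c n‖ ≤ 2 * ε k * (s N).card :=
    ae_all_iff.2 fun C => ae_all_iff.2 fun k =>
      ae_eventually_forall_norm_weighted_sum_le hind
        (fun n => hsign.comp (measurable_pi_apply n)) (fun n ω => abs_skewSign_le _) hmean s hgrow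
        (G C k) (hG1 C k) (M C (ε k)) (fun N h2 => (hG2 C k N h2).1) (hεpos k)
  obtain ⟨ω, hω⟩ := hae.exists
  refine ⟨fun n => skewSign (ω n), fun n _ => skewSign_eq _, fun C a ha => ?_⟩
  rw [Metric.tendsto_nhds]
  intro δ hδ
  obtain ⟨k, hk⟩ := exists_nat_gt (5 / δ)
  have hkδ : 5 * ε k < δ := by
    have hk2 : 5 < δ * k := by rwa [div_lt_iff₀' hδ] at hk
    rw [mul_one_div, div_lt_iff₀ (by positivity)]
    linarith
  filter_upwards [hω C k, hcardS.eventually_ge_atTop (2 / ε k), eventually_ge_atTop 2]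
    with N hN hK h2
  obtain ⟨c, hc, hac⟩ := (hG2 C k N h2).2 a ha
  have hKpos : (0 : ℝ) < (s N).card := lt_of_lt_of_le (div_pos two_pos (hεpos k)) hK
  have hle := norm_sum_le_of_close (s := s N) (N := N) (x := fun n => skewSign (ω n))
    (fun n hn => Nat.lt_succ_iff.1 (Finset.mem_range.1 (Finset.mem_filter.1 hn).1))
    (fun n => abs_skewSign_le _) (hbd C a ha) (hG1 C k N c hc)
    (mul_nonneg zero_le_two (hεpos k).le) hac
  rw [div_le_iff₀ (hεpos k)] at hK
  rw [dist_zero_right, norm_div, Complex.norm_natCast, div_lt_iff₀ hKpos]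
  calc ‖∑ n ∈ s N, (skewSign (ω n) : ℂ) * a n‖ ≤ 5 * ε k * (s N).card := by
        linarith [hN c hc]
    _ < δ * (s N).card := by gcongr
end

section
/- For every ε ∈ (0,1) there is a constant C(ε) > 0 such that for all integers N ≥ 1, the set Ξ_N := {(e(αn⌊βn⌋))_{n=1}^N : α ∈ [0,1), β ∈ [0,1)} ⊆ ℂ^N can be covered by at most C(ε) · N^4 closed balls of radius ε in the supremum norm on ℂ^N. -/
/-- The phase `x ↦ e^{2πix}` is `2π`-Lipschitz on the real line. -/
lemma norm_exp_two_pi_I_mul_sub_le (x y : ℝ) :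
    ‖Complex.exp (2 * Real.pi * Complex.I * x) - Complex.exp (2 * Real.pi * Complex.I * y)‖
      ≤ 2 * Real.pi * |x - y| := by
  have h : Complex.exp (2 * Real.pi * Complex.I * x) - Complex.exp (2 * Real.pi * Complex.I * y)
      = Complex.exp ((2 * Real.pi * y : ℝ) * Complex.I) *
        (Complex.exp (Complex.I * (2 * Real.pi * (x - y) : ℝ)) - 1) := by
    rw [mul_sub, ← Complex.exp_add, mul_one]
    congr 2 <;> push_cast <;> ring
  rw [h, norm_mul, Complex.norm_exp_ofReal_mul_I, one_mul]
  refine (Real.norm_exp_I_mul_ofReal_sub_one_le (x := 2 * Real.pi * (x - y))).trans_eq ?_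
  rw [Real.norm_eq_abs, abs_mul, abs_of_pos Real.two_pi_pos]

/-- The initial segment `⌊β⌋, ⌊2β⌋, …, ⌊Nβ⌋` of a Beatty sequence with slope in `[0, 1)` is also
attained by a slope which is a fraction in `[0, 1)` with denominator at most `N`. -/
lemma exists_fraction_floor_mul_eq {N : ℕ} (hN : 1 ≤ N) {β : ℝ} (hβ : β ∈ Set.Ico (0 : ℝ) 1) :
    ∃ p < N, ∃ q < N, ∀ n < N,
      ⌊((p : ℝ) / ((q : ℝ) + 1)) * ((n : ℝ) + 1)⌋ = ⌊β * ((n : ℝ) + 1)⌋ := by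
  obtain ⟨hβ0, hβ1⟩ := hβ
  obtain ⟨q, hq, hmax⟩ := Finset.exists_max_image (Finset.range N)
    (fun n : ℕ => (⌊β * ((n : ℝ) + 1)⌋₊ : ℝ) / ((n : ℝ) + 1)) ⟨0, Finset.mem_range.2 hN⟩
  rw [Finset.mem_range] at hq
  have hq0 : (0 : ℝ) < (q : ℝ) + 1 := by positivity
  have hfloor : (⌊β * ((q : ℝ) + 1)⌋₊ : ℝ) ≤ β * ((q : ℝ) + 1) := Nat.floor_le (by positivity)
  refine ⟨⌊β * ((q : ℝ) + 1)⌋₊, ?_, q, hq, fun n hn => ?_⟩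
  · have : (⌊β * ((q : ℝ) + 1)⌋₊ : ℝ) < ((q + 1 : ℕ) : ℝ) := by push_cast; nlinarith
    have := Nat.cast_lt.1 this
    omega
  · have hn0 : (0 : ℝ) < (n : ℝ) + 1 := by positivity
    have hn := hmax n (Finset.mem_range.2 hn)
    rw [div_le_iff₀ hn0] at hn
    rw [← Int.natCast_floor_eq_floor (by positivity : 0 ≤ β * ((n : ℝ) + 1)), Int.floor_eq_iff]
    refine ⟨by exact_mod_cast hn, lt_of_le_of_lt ?_ (Nat.lt_floor_add_one (β * ((n : ℝ) + 1)))⟩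
    exact mul_le_mul_of_nonneg_right ((div_le_iff₀ hq0).2 hfloor) hn0.le

/-- Every point of `[0, 1)` is within `1 / K` of a fraction in `[0, 1)` with denominator `K`. -/
lemma exists_nat_lt_abs_sub_div_le {K : ℕ} (hK : 0 < K) {α : ℝ} (hα : α ∈ Set.Ico (0 : ℝ) 1) :
    ∃ k < K, |α - (k : ℝ) / K| ≤ 1 / K := by
  obtain ⟨hα0, hα1⟩ := hα
  have hK' : (0 : ℝ) < K := by exact_mod_cast hK
  have h1 : (⌊α * K⌋₊ : ℝ) ≤ α * K := Nat.floor_le (by positivity)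
  have h2 := Nat.lt_floor_add_one (α * K)
  refine ⟨⌊α * K⌋₊, ?_, ?_⟩
  · have : (⌊α * K⌋₊ : ℝ) < K := by nlinarith
    exact_mod_cast this
  · have h : α - (⌊α * K⌋₊ : ℝ) / K = (α * K - ⌊α * K⌋₊) / K := by field_simp
    rw [h, abs_of_nonneg (by apply div_nonneg <;> linarith)]
    gcongr
    linarith

/-- For every `ε ∈ (0,1)` there is a constant `C(ε) > 0` such that the set
`Ξ_N = {(e(αn⌊βn⌋))_{n=1}^N : α, β ∈ [0,1)}` can be covered by at most
`C(ε) · N⁴` closed balls of radius `ε` in the sup norm on `ℂ^N`. -/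
theorem stmt_11 (ε : ℝ) (hε : ε ∈ Set.Ioo (0 : ℝ) 1) :
    ∃ C : ℝ, 0 < C ∧ ∀ N : ℕ, 1 ≤ N →
      ∃ T : Finset (Fin N → ℂ), (T.card : ℝ) ≤ C * (N : ℝ) ^ 4 ∧
        ∀ α ∈ Set.Ico (0 : ℝ) 1, ∀ β ∈ Set.Ico (0 : ℝ) 1, ∃ c ∈ T, ∀ n : Fin N,
          ‖
              (Complex.exp (2 * Real.pi * Complex.I *
                  (α * ((n : ℕ) + 1) * ⌊β * ((n : ℕ) + 1)⌋)) - c n)‖ ≤ ε := by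
  classical
  have hε0 : 0 < ε := hε.1
  obtain ⟨M, hM⟩ := exists_nat_ge (2 * Real.pi / ε)
  have hM0 : (0 : ℝ) < M := lt_of_lt_of_le (by positivity) hM
  rw [div_le_iff₀ hε0] at hM
  refine ⟨M, hM0, fun N hN => ?_⟩
  have hN0 : (0 : ℝ) < N := by exact_mod_cast hN
  have hK : 0 < M * N ^ 2 := Nat.mul_pos (by exact_mod_cast hM0) (by positivity)
  let point : ℕ × ℕ × ℕ → Fin N → ℂ := fun t n =>
    Complex.exp (2 * Real.pi * Complex.I * (((t.1 : ℝ) / (M * N ^ 2 : ℕ) * ((n : ℕ) + 1) *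
      ⌊((t.2.1 : ℝ) / ((t.2.2 : ℝ) + 1)) * (((n : ℕ) : ℝ) + 1)⌋ : ℝ) : ℂ))
  refine ⟨(Finset.range (M * N ^ 2) ×ˢ Finset.range N ×ˢ Finset.range N).image point, ?_, ?_⟩
  · have h := Finset.card_image_le (f := point)
      (s := Finset.range (M * N ^ 2) ×ˢ Finset.range N ×ˢ Finset.range N)
    simp only [Finset.card_product, Finset.card_range] at h
    calc _ ≤ ((M * N ^ 2 * (N * N) : ℕ) : ℝ) := by exact_mod_cast h
      _ = M * (N : ℝ) ^ 4 := by push_cast; ring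
  · intro α hα β hβ
    obtain ⟨k, hk, hαk⟩ := exists_nat_lt_abs_sub_div_le hK hα
    obtain ⟨p, hp, q, hq, hpq⟩ := exists_fraction_floor_mul_eq hN hβ
    refine ⟨point (k, p, q), Finset.mem_image_of_mem _ (by simp [hk, hp, hq]), fun n => ?_⟩
    have hn : ((n : ℕ) : ℝ) + 1 ≤ N := by exact_mod_cast n.2
    have hβn : 0 ≤ β * (((n : ℕ) : ℝ) + 1) := mul_nonneg hβ.1 (by positivity)
    have hm0 : (0 : ℝ) ≤ ⌊β * (((n : ℕ) : ℝ) + 1)⌋ := by exact_mod_cast Int.floor_nonneg.2 hβn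
    have hmN : (⌊β * (((n : ℕ) : ℝ) + 1)⌋ : ℝ) ≤ N :=
      (Int.floor_le _).trans ((mul_le_of_le_one_left (by positivity) hβ.2.le).trans hn)
    have h := norm_exp_two_pi_I_mul_sub_le (α * ((n : ℕ) + 1) * ⌊β * (((n : ℕ) : ℝ) + 1)⌋)
      ((k : ℝ) / (M * N ^ 2 : ℕ) * ((n : ℕ) + 1) * ⌊β * (((n : ℕ) : ℝ) + 1)⌋)
    simp only [point, hpq n n.2]
    refine (le_of_eq (by push_cast; rfl)).trans (h.trans ?_)
    rw [← sub_mul, ← sub_mul, abs_mul, abs_mul, abs_of_nonneg hm0,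
      abs_of_nonneg (by positivity : (0 : ℝ) ≤ ((n : ℕ) : ℝ) + 1)]
    calc _ ≤ 2 * Real.pi * (1 / (M * N ^ 2 : ℕ) * N * N) := by gcongr
      _ = 2 * Real.pi / M := by push_cast; field_simp
      _ ≤ ε := by rw [div_le_iff₀ hM0]; linarith
end

section
/- For every integer k ≥ 1 and every ε ∈ (0,1) there is a constant C(k, ε) > 0 such that for all integers N ≥ 1, the set {(e(∑_{i=1}^k α_i n ⌊β_i n⌋))_{n=1}^N : α_1, …, α_k ∈ [0,1), β_1, …, β_k ∈ [0,1)} ⊆ ℂ^N can be covered by at most C(k, ε) · N^{4k} closed balls of radius ε in the supremum norm on ℂ^N. -/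
/-- A map whose values are classified by finitely many codes has a finite set of values
representing every code, with at most as many elements as there are codes. -/
lemma exists_finset_representatives {X V κ : Type*} (f : X → V) (code : X → κ)
    (s : Finset κ) (hs : ∀ x, code x ∈ s) :
    ∃ T : Finset V, T.card ≤ s.card ∧ ∀ x, ∃ y, f y ∈ T ∧ code y = code x := by
  classical
  let g : Set.range code → V := fun p => f (Set.rangeSplitting code p)
  have hfin : (Set.range code).Finite :=
    s.finite_toSet.subset (by rintro _ ⟨x, rfl⟩; exact hs x)
  have : Fintype (Set.range code) := hfin.fintype
  refine ⟨Finset.univ.image g, ?_, fun x => ?_⟩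
  · refine Finset.card_image_le.trans ?_
    rw [← Finset.card_map ⟨Subtype.val, Subtype.val_injective⟩]
    refine Finset.card_le_card fun p hp => ?_
    obtain ⟨⟨_, x, rfl⟩, -, rfl⟩ := Finset.mem_map.1 hp
    exact hs x
  · exact ⟨Set.rangeSplitting code ⟨code x, x, rfl⟩,
      Finset.mem_image_of_mem g (Finset.mem_univ _), Set.apply_rangeSplitting code _⟩

/-- The floors `⌊β n⌋`, `1 ≤ n ≤ N`, are determined by their sum, since they are monotone
in `β`. -/
lemma floor_mul_eq_of_sum_eq {N : ℕ} {β γ : ℝ}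
    (h : ∑ n : Fin N, ⌊β * ((n : ℕ) + 1)⌋ = ∑ n : Fin N, ⌊γ * ((n : ℕ) + 1)⌋) (n : Fin N) :
    ⌊β * ((n : ℕ) + 1)⌋ = ⌊γ * ((n : ℕ) + 1)⌋ := by
  have mono : ∀ {x y : ℝ}, x ≤ y → ∀ m ∈ (Finset.univ : Finset (Fin N)),
      ⌊x * ((m : ℕ) + 1)⌋ ≤ ⌊y * ((m : ℕ) + 1)⌋ := fun hxy m _ => by gcongr
  rcases le_total β γ with hle | hle
  · exact (Finset.sum_eq_sum_iff_of_le (mono hle)).1 h n (Finset.mem_univ n)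
  · exact ((Finset.sum_eq_sum_iff_of_le (mono hle)).1 h.symm n (Finset.mem_univ n)).symm

lemma floor_mul_nonneg {β : ℝ} (hβ : β ∈ Set.Ico (0 : ℝ) 1) (n : ℕ) :
    0 ≤ ⌊β * (n + 1)⌋ :=
  Int.floor_nonneg.2 (mul_nonneg hβ.1 (by positivity))

lemma floor_mul_le {β : ℝ} (hβ : β ∈ Set.Ico (0 : ℝ) 1) {N n : ℕ} (hn : n < N) :
    ⌊β * (n + 1)⌋ ≤ N := by
  have hn' : (n : ℝ) + 1 ≤ N := by exact_mod_cast hn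
  refine Int.floor_le_iff.2 ?_
  have : β * (n + 1) ≤ 1 * (n + 1) := by gcongr; exact hβ.2.le
  push_cast
  linarith

/-- The map `t ↦ e(t)` is Lipschitz with constant `2π`. -/
lemma norm_exp_two_pi_sub_le (a b : ℝ) :
    ‖Complex.exp (2 * Real.pi * Complex.I * a) - Complex.exp (2 * Real.pi * Complex.I * b)‖ ≤
      2 * Real.pi * |a - b| := by
  have hb : ‖Complex.exp (2 * Real.pi * Complex.I * b)‖ = 1 := by
    rw [show (2 * Real.pi * Complex.I * b : ℂ) = ((2 * Real.pi * b : ℝ) : ℂ) * Complex.I by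
      push_cast; ring, Complex.norm_exp_ofReal_mul_I]
  have hfac : Complex.exp (2 * Real.pi * Complex.I * a) -
      Complex.exp (2 * Real.pi * Complex.I * b) =
      Complex.exp (2 * Real.pi * Complex.I * b) *
        (Complex.exp (Complex.I * (2 * Real.pi * (a - b) : ℝ)) - 1) := by
    rw [mul_sub, ← Complex.exp_add, mul_one]
    congr 2
    push_cast
    ring
  rw [hfac, norm_mul, hb, one_mul]
  refine Real.norm_exp_I_mul_ofReal_sub_one_le.trans_eq ?_
  rw [Real.norm_eq_abs, abs_mul, abs_of_pos Real.two_pi_pos]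

/-- Moving the coefficients `α i` by at most `1 / (M N²)` moves `∑ α i n ⌊β i n⌋` by at most
`k / M`. -/
lemma abs_sum_floor_sub_le {k N M : ℕ} (hN : 0 < N) (hM : 0 < M) {α α' β : Fin k → ℝ}
    (hβ : ∀ i, β i ∈ Set.Ico (0 : ℝ) 1)
    (hα : ∀ i, ⌊α i * (M * N ^ 2 : ℝ)⌋ = ⌊α' i * (M * N ^ 2 : ℝ)⌋) (n : Fin N) :
    |∑ i, α i * ((n : ℕ) + 1) * ⌊β i * ((n : ℕ) + 1)⌋ -
      ∑ i, α' i * ((n : ℕ) + 1) * ⌊β i * ((n : ℕ) + 1)⌋| ≤ k / M := by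
  have hN' : (0 : ℝ) < N := by exact_mod_cast hN
  have hM' : (0 : ℝ) < M := by exact_mod_cast hM
  have hn : ((n : ℕ) : ℝ) + 1 ≤ N := by exact_mod_cast n.2
  rw [← Finset.sum_sub_distrib]
  refine (Finset.abs_sum_le_sum_abs _ _).trans ?_
  have hterm : ∀ i ∈ (Finset.univ : Finset (Fin k)),
      |α i * ((n : ℕ) + 1) * ⌊β i * ((n : ℕ) + 1)⌋ -
        α' i * ((n : ℕ) + 1) * ⌊β i * ((n : ℕ) + 1)⌋| ≤ 1 / M := by
    intro i _
    have h0 : (0 : ℝ) ≤ ⌊β i * ((n : ℕ) + 1)⌋ := by exact_mod_cast floor_mul_nonneg (hβ i) n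
    have h1 : (⌊β i * ((n : ℕ) + 1)⌋ : ℝ) ≤ N := by exact_mod_cast floor_mul_le (hβ i) n.2
    have hd := (Int.abs_sub_lt_one_of_floor_eq_floor (hα i)).le
    rw [← sub_mul, abs_mul, abs_of_pos (by positivity : (0 : ℝ) < M * N ^ 2)] at hd
    rw [← sub_mul, ← sub_mul, abs_mul, abs_mul, abs_of_nonneg h0,
      abs_of_pos (by positivity : (0 : ℝ) < ((n : ℕ) : ℝ) + 1), le_div_iff₀ hM']
    calc |α i - α' i| * ((n : ℕ) + 1) * ⌊β i * ((n : ℕ) + 1)⌋ * M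
        ≤ |α i - α' i| * N * N * M := by gcongr
      _ = |α i - α' i| * (M * N ^ 2) := by ring
      _ ≤ 1 := hd
  refine (Finset.sum_le_card_nsmul _ _ _ hterm).trans_eq ?_
  rw [Finset.card_univ, Fintype.card_fin, nsmul_eq_mul, mul_one_div]


/-- For every `k ≥ 1` and `ε ∈ (0,1)` there is `C(k,ε) > 0` such that the set of
tuples `(e(∑_{i=1}^k α_i n ⌊β_i n⌋))_{n=1}^N`, with `α_i, β_i ∈ [0,1)`, can be
covered by at most `C(k,ε) · N^{4k}` closed balls of radius `ε` in the sup norm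
on `ℂ^N`. -/
theorem stmt_12 (k : ℕ) (hk : 1 ≤ k) (ε : ℝ) (hε : ε ∈ Set.Ioo (0 : ℝ) 1) :
    ∃ C : ℝ, 0 < C ∧ ∀ N : ℕ, 1 ≤ N →
      ∃ T : Finset (Fin N → ℂ), (T.card : ℝ) ≤ C * (N : ℝ) ^ (4 * k) ∧
        ∀ α : Fin k → ℝ, (∀ i, α i ∈ Set.Ico (0 : ℝ) 1) →
        ∀ β : Fin k → ℝ, (∀ i, β i ∈ Set.Ico (0 : ℝ) 1) →
          ∃ c ∈ T, ∀ n : Fin N,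
            norm (E := ℂ)
                (Complex.exp (2 * Real.pi * Complex.I *
                    (∑ i : Fin k, α i * ((n : ℕ) + 1) * ⌊β i * ((n : ℕ) + 1)⌋)) -
                  c n) ≤ ε := by
  obtain ⟨hε0, -⟩ := hε
  obtain ⟨M, hM⟩ := exists_nat_gt (2 * Real.pi * k / ε)
  have hM' : (0 : ℝ) < M := lt_of_le_of_lt (by positivity) hM
  have hM0 : 0 < M := by exact_mod_cast hM'
  refine ⟨(2 * M) ^ k, by positivity, fun N hN => ?_⟩
  have hN' : (1 : ℝ) ≤ N := by exact_mod_cast hN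
  let I := Set.Ico (0 : ℝ) 1
  let f : (Fin k → I × I) → Fin N → ℂ := fun x n =>
    Complex.exp (2 * Real.pi * Complex.I *
      ((∑ i, (x i).1 * ((n : ℕ) + 1) * ⌊((x i).2 : ℝ) * ((n : ℕ) + 1)⌋ : ℝ) : ℂ))
  let code : (Fin k → I × I) → Fin k → ℤ × ℤ := fun x i =>
    (⌊((x i).1 : ℝ) * (M * N ^ 2 : ℝ)⌋, ∑ n : Fin N, ⌊((x i).2 : ℝ) * ((n : ℕ) + 1)⌋)
  let s : Finset (Fin k → ℤ × ℤ) := Fintype.piFinset fun _ =>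
    Finset.Ico (0 : ℤ) (M * N ^ 2 : ℕ) ×ˢ Finset.Ico (0 : ℤ) (N ^ 2 + 1 : ℕ)
  have hs : ∀ x, code x ∈ s := by
    refine fun x => Fintype.mem_piFinset.2 fun i => Finset.mem_product.2
      ⟨Finset.mem_Ico.2 ⟨?_, ?_⟩, Finset.mem_Ico.2 ⟨?_, ?_⟩⟩
    · exact Int.floor_nonneg.2 (mul_nonneg (x i).1.2.1 (by positivity))
    · refine Int.floor_lt.2 ?_
      push_cast
      exact mul_lt_of_lt_one_left (by positivity) (x i).1.2.2
    · exact Finset.sum_nonneg (s := Finset.univ) fun (n : Fin N) _ => floor_mul_nonneg (x i).2.2 n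
    · have := Finset.sum_le_card_nsmul (Finset.univ : Finset (Fin N)) _ (N : ℤ)
        fun n _ => floor_mul_le (x i).2.2 n.2
      rw [Finset.card_univ, Fintype.card_fin, nsmul_eq_mul, ← pow_two] at this
      push_cast
      exact Int.lt_add_one_of_le this
  have hcard : (s.card : ℝ) ≤ (2 * M) ^ k * (N : ℝ) ^ (4 * k) := by
    rw [Fintype.card_piFinset_const, Finset.card_product, Int.card_Ico, Int.card_Ico, sub_zero,
      sub_zero, Int.toNat_natCast, Int.toNat_natCast, pow_mul, ← mul_pow]
    push_cast
    refine pow_le_pow_left₀ (by positivity) ?_ k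
    have : (1 : ℝ) ≤ (N : ℝ) ^ 2 := one_le_pow₀ hN'
    calc (M : ℝ) * N ^ 2 * (N ^ 2 + 1) ≤ M * N ^ 2 * (N ^ 2 + N ^ 2) := by gcongr
      _ = 2 * (M : ℝ) * N ^ 4 := by ring
  obtain ⟨T, hT, hcover⟩ := exists_finset_representatives f code s hs
  refine ⟨T, le_trans (by exact_mod_cast hT) hcard, fun α hα β hβ => ?_⟩
  obtain ⟨y, hyT, hy⟩ := hcover fun i => (⟨α i, hα i⟩, ⟨β i, hβ i⟩)
  refine ⟨f y, hyT, fun n => ?_⟩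
  have hfloor : ∀ i, ⌊((y i).2 : ℝ) * ((n : ℕ) + 1)⌋ = ⌊β i * ((n : ℕ) + 1)⌋ := fun i =>
    floor_mul_eq_of_sum_eq (congrArg Prod.snd (congrFun hy i)) n
  have hdiff := abs_sum_floor_sub_le hN hM0 hβ (α := α) (α' := fun i => (y i).1)
    (fun i => (congrArg Prod.fst (congrFun hy i)).symm) n
  have hexp := norm_exp_two_pi_sub_le
    (∑ i, α i * ((n : ℕ) + 1) * ⌊β i * ((n : ℕ) + 1)⌋)
    (∑ i, (y i).1 * ((n : ℕ) + 1) * ⌊β i * ((n : ℕ) + 1)⌋)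
  have hbound : 2 * Real.pi * (k / M) ≤ ε := by
    rw [← mul_div_assoc, div_le_iff₀ hM']
    rw [div_lt_iff₀ hε0] at hM
    linarith
  have hfinal := hexp.trans ((mul_le_mul_of_nonneg_left hdiff Real.two_pi_pos.le).trans hbound)
  simp only [f, hfloor]
  push_cast at hfinal ⊢
  exact hfinal
end

section
/- Let A ⊂ ℝ be a finite set, let r ≥ 1 be an integer, suppose that for each k ∈ ℕ we have functions f_{0,k}, …, f_{r,k} : ℤ_{≥0} → A, and let (N_k)_{k=1}^∞ be a strictly increasing sequence of positive integers. Then there exist a probability space (X, 𝓑, μ), a measure-preserving map T : X → X, and bounded measurable functions F_0, F_1, …, F_r : X → ℝ such that the following holds: for every tuple (d_1, …, d_r) of distinct positive integers for which the limit S(d_1, …, d_r) := lim_{k→∞} (1/N_k) ∑_{n=0}^{N_k − 1} f_{0,k}(n) f_{1,k}(n + d_1) ⋯ f_{r,k}(n + d_r) exists, one has S(d_1, …, d_r) = ∫_X F_0 · (F_1 ∘ T^{d_1}) · (F_2 ∘ T^{d_2}) ⋯ (F_r ∘ T^{d_r}) dμ. -/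
open MeasureTheory Filter

open scoped Topology BoundedContinuousFunction ENNReal

/-- The empirical measure of the first `n` points of the orbit of `x` under `T`. -/
noncomputable def orbitMeasure {X : Type*} [MeasurableSpace X] (T : X → X) (n : ℕ) (x : X) :
    Measure X :=
  (n : ℝ≥0∞)⁻¹ • ∑ j ∈ Finset.range n, Measure.dirac (T^[j] x)

theorem isProbabilityMeasure_orbitMeasure {X : Type*} [MeasurableSpace X] (T : X → X) {n : ℕ}
    (hn : 0 < n) (x : X) : IsProbabilityMeasure (orbitMeasure T n x) := by
  constructor
  simp only [orbitMeasure, Measure.smul_apply, Measure.finsetSum_apply, measure_univ,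
    Finset.sum_const, Finset.card_range, nsmul_eq_mul, mul_one, smul_eq_mul]
  exact ENNReal.inv_mul_cancel (by exact_mod_cast hn.ne') (ENNReal.natCast_ne_top n)

theorem integral_orbitMeasure {X : Type*} [MeasurableSpace X] [TopologicalSpace X]
    [OpensMeasurableSpace X] (T : X → X) (n : ℕ) (x : X) (g : X →ᵇ ℝ) :
    ∫ y, g y ∂(orbitMeasure T n x) = birkhoffAverage ℝ T g n x := by
  have hg : StronglyMeasurable (g : X → ℝ) := g.continuous.measurable.stronglyMeasurable
  rw [orbitMeasure, integral_smul_measure, integral_finsetSum_measure]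
  · simp [integral_dirac' _ _ hg, birkhoffAverage, birkhoffSum]
  · exact fun j _ => g.integrable (Measure.dirac (T^[j] x))

/-- On a compact space, the empirical measures along orbit segments whose lengths tend to infinity
have an invariant weak limit point. -/
theorem exists_measurePreserving_tendsto_birkhoffAverage {X : Type*} [MeasurableSpace X]
    [TopologicalSpace X] [CompactSpace X] [T2Space X] [BorelSpace X] [HasOuterApproxClosed X]
    {T : X → X} (hT : Continuous T) (x : ℕ → X) {N : ℕ → ℕ} (hN : ∀ k, 0 < N k)
    (hN' : Tendsto N atTop atTop) (U : Ultrafilter ℕ) (hU : ↑U ≤ (atTop : Filter ℕ)) :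
    ∃ μ : Measure X, IsProbabilityMeasure μ ∧ MeasurePreserving T μ μ ∧
      ∀ g : X →ᵇ ℝ,
        Tendsto (fun k => birkhoffAverage ℝ T g (N k) (x k)) U (𝓝 (∫ y, g y ∂μ)) := by
  let ν : ℕ → ProbabilityMeasure X := fun k =>
    ⟨orbitMeasure T (N k) (x k), isProbabilityMeasure_orbitMeasure T (hN k) (x k)⟩
  obtain ⟨μ, -, hμ⟩ := isCompact_univ.ultrafilter_le_nhds (U.map ν) (by simp)
  have hlim : ∀ g : X →ᵇ ℝ, Tendsto (fun k => birkhoffAverage ℝ T g (N k) (x k)) U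
      (𝓝 (∫ y, g y ∂(μ : Measure X))) := by
    intro g
    have h := ProbabilityMeasure.tendsto_iff_forall_integral_tendsto.1
      (show Tendsto ν U (𝓝 μ) from hμ) g
    simpa only [ν, ProbabilityMeasure.coe_mk, integral_orbitMeasure] using h
  refine ⟨μ, inferInstance, ⟨hT.measurable, ?_⟩, hlim⟩
  have := Measure.isProbabilityMeasure_map (μ := (μ : Measure X)) hT.measurable.aemeasurable
  refine ext_of_forall_integral_eq_of_IsFiniteMeasure fun g => ?_
  rw [integral_map hT.measurable.aemeasurable
    g.continuous.measurable.stronglyMeasurable.aestronglyMeasurable]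
  have hshift := (hlim (g.compContinuous ⟨T, hT⟩)).sub (hlim g)
  have hzero : Tendsto (fun k => birkhoffAverage ℝ T (g.compContinuous ⟨T, hT⟩) (N k) (x k)
      - birkhoffAverage ℝ T g (N k) (x k)) atTop (𝓝 0) := by
    have hN'' : Tendsto (fun k => 2 * ‖g‖ / (N k : ℝ)) atTop (𝓝 0) :=
      (tendsto_const_nhds.div_atTop tendsto_natCast_atTop_atTop).comp hN'
    refine squeeze_zero_norm (fun k => ?_) hN''
    have hcomm : birkhoffAverage ℝ T (g.compContinuous ⟨T, hT⟩) (N k) (x k)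
        = birkhoffAverage ℝ T g (N k) (T (x k)) := by
      simp [birkhoffAverage, birkhoffSum, Function.Commute.iterate_self T _ _]
    rw [hcomm, birkhoffAverage_apply_sub_birkhoffAverage, smul_eq_mul, norm_mul, norm_inv,
      Real.norm_natCast, mul_comm, div_eq_mul_inv]
    gcongr
    exact (dist_eq_norm _ _).symm.trans_le (g.dist_le_two_norm _ _)
  exact sub_eq_zero.1 (tendsto_nhds_unique hshift (hzero.mono_left hU))

/-- Furstenberg-type correspondence principle (Proposition 5.1): given functions
`f_{0,k}, …, f_{r,k} : ℕ → A` (`A ⊂ ℝ` finite) and an increasing sequence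
`(N_k)`, there is a probability measure-preserving system `(X, μ, T)` and
bounded measurable `F_0, …, F_r` such that whenever `(d_1, …, d_r)` are
distinct positive integers for which the limit
`S(d) = lim_k (1/N_k) ∑_{n < N_k} f_{0,k}(n) ∏ f_{i,k}(n + d_i)` exists,
it equals `∫ F_0 · ∏ F_i ∘ T^{d_i} dμ`. -/
theorem stmt_13 (A : Finset ℝ) (r : ℕ) (hr : 1 ≤ r)
    (f : ℕ → Fin (r + 1) → ℕ → ℝ) (hf : ∀ k i n, f k i n ∈ A)
    (N : ℕ → ℕ) (hNpos : ∀ k, 0 < N k) (hNmono : StrictMono N) :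
    ∃ (X : Type) (_ : MeasurableSpace X) (μ : Measure X)
      (_ : IsProbabilityMeasure μ) (T : X → X) (F : Fin (r + 1) → X → ℝ),
      MeasurePreserving T μ μ ∧
      (∀ i, Measurable (F i)) ∧
      (∀ i, ∃ c : ℝ, ∀ x, |F i x| ≤ c) ∧
      ∀ d : Fin r → ℕ, (∀ i, 0 < d i) → Function.Injective d →
        ∀ L : ℝ,
          Tendsto (fun k : ℕ =>
              (∑ n ∈ Finset.range (N k),
                f k 0 n * ∏ i : Fin r, f k i.succ (n + d i)) / (N k : ℝ))
            atTop (nhds L) →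
          ∫ x, F 0 x * ∏ i : Fin r, F i.succ (T^[d i] x) ∂μ = L := by
  let X := ℕ → Fin (r + 1) → A
  have : BorelSpace X := Pi.borelSpace
  let T : X → X := fun x n => x (n + 1)
  have hT : Continuous T := by fun_prop
  have hTiter : ∀ (m : ℕ) (x : X) (n : ℕ), T^[m] x n = x (n + m) := by
    intro m
    induction m with
    | zero => simp
    | succ m ih => intro x n; rw [Function.iterate_succ_apply, ih]; rfl
  let F : Fin (r + 1) → X → ℝ := fun i x => x 0 i
  have hF : ∀ i, Continuous (F i) := by fun_prop
  let x : ℕ → X := fun k n i => ⟨f k i n, hf k i n⟩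
  obtain ⟨μ, hprob, hpres, hlim⟩ := exists_measurePreserving_tendsto_birkhoffAverage hT x hNpos
    hNmono.tendsto_atTop (hyperfilter ℕ) Nat.hyperfilter_le_atTop
  refine ⟨X, inferInstance, μ, hprob, T, F, hpres, fun i => (hF i).measurable, fun i => ?_, ?_⟩
  · obtain ⟨c, hc⟩ := isCompact_univ.exists_bound_of_continuousOn (hF i).continuousOn
    exact ⟨c, fun y => hc y (Set.mem_univ y)⟩
  · intro d _ _ L hL
    have hcont : Continuous fun y => F 0 y * ∏ i : Fin r, F i.succ (T^[d i] y) :=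
      (hF 0).mul (continuous_finsetProd _ fun i _ => (hF i.succ).comp (hT.iterate (d i)))
    have hav := hlim (BoundedContinuousFunction.mkOfCompact ⟨_, hcont⟩)
    refine tendsto_nhds_unique hav ((hL.mono_left Nat.hyperfilter_le_atTop).congr fun k => ?_)
    simp [birkhoffAverage, birkhoffSum, F, x, hTiter, div_eq_inv_mul, add_comm]
end

section
/- For every function η : 𝒮 → {1, −1/3} there exist a probability space (X, 𝓑, μ), a measure-preserving map T : X → X, and bounded measurable functions F_0, F_1, F_2 : X → ℝ such that for every d ∈ 𝒮, ∫_X F_0 · (F_1 ∘ T^d) · (F_2 ∘ T^{2d}) dμ = η(d). -/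
open MeasureTheory Filter

/-- If the triple correlations of a sequence of measure-preserving systems, taken on functions
bounded by `1`, converge, then the limits are triple correlations of a single system. -/
theorem exists_system_of_tendsto_correlation {X : ℕ → Type*} [∀ k, MeasurableSpace (X k)]
    (μ : ∀ k, Measure (X k)) [∀ k, IsProbabilityMeasure (μ k)] {T : ∀ k, X k → X k}
    (hT : ∀ k, MeasurePreserving (T k) (μ k) (μ k)) {f : ∀ k, Fin 3 → X k → ℝ}
    (hf : ∀ k i, Measurable (f k i)) (hf1 : ∀ k i x, |f k i x| ≤ 1) {S : Set ℕ} {L : ℕ → ℝ}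
    (hL : ∀ d ∈ S, Tendsto (fun k => ∫ x, f k 0 x * f k 1 ((T k)^[d] x) *
      f k 2 ((T k)^[2 * d] x) ∂μ k) atTop (nhds (L d))) :
    ∃ (Ω : Type) (_ : MeasurableSpace Ω) (ν : Measure Ω) (_ : IsProbabilityMeasure ν)
      (σ : Ω → Ω) (F : Fin 3 → Ω → ℝ), MeasurePreserving σ ν ν ∧ (∀ i, Measurable (F i)) ∧
      (∀ i x, |F i x| ≤ 1) ∧
      ∀ d ∈ S, ∫ x, F 0 x * F 1 (σ^[d] x) * F 2 (σ^[2 * d] x) ∂ν = L d := by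
  let Ω := ℕ → Fin 3 → Set.Icc (-1 : ℝ) 1
  let σ : Ω → Ω := fun w n => w (n + 1)
  have hσ : Continuous σ := continuous_pi fun n => continuous_apply (n + 1)
  have hσ_iter : ∀ (d : ℕ) (w : Ω), σ^[d] w = fun n => w (n + d) := by
    intro d
    induction d with
    | zero => intro w; rfl
    | succ d ih =>
      intro w
      rw [Function.iterate_succ_apply, ih]
      funext n
      exact congrArg w (by ring)
  let F : Fin 3 → Ω → ℝ := fun i w => w 0 i
  have hF : ∀ i, Continuous (F i) := fun i => by fun_prop
  let φ : ∀ k, X k → Ω := fun k x n i => ⟨f k i ((T k)^[n] x), abs_le.1 (hf1 k i _)⟩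
  have hφ : ∀ k, Measurable (φ k) := fun k => measurable_pi_lambda _ fun n =>
    measurable_pi_lambda _ fun i =>
      ((hf k i).comp ((hT k).measurable.iterate n)).subtype_mk
  have hσφ : ∀ k, σ ∘ φ k = φ k ∘ T k := fun k => rfl
  let ν : ℕ → ProbabilityMeasure Ω := fun k =>
    ⟨(μ k).map (φ k), Measure.isProbabilityMeasure_map (hφ k).aemeasurable⟩
  have hν : ∀ k, (ν k).map hσ.measurable.aemeasurable = ν k := by
    intro k
    apply Subtype.ext
    change ((μ k).map (φ k)).map σ = (μ k).map (φ k)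
    rw [Measure.map_map hσ.measurable (hφ k), hσφ,
      ← Measure.map_map (hφ k) (hT k).measurable, (hT k).map_eq]
  obtain ⟨m, -, hm⟩ := isCompact_univ.ultrafilter_le_nhds
    ((hyperfilter ℕ : Ultrafilter ℕ).map ν) (by simp)
  have hm : Tendsto ν (hyperfilter ℕ) (nhds m) := hm
  have hle : (hyperfilter ℕ : Filter ℕ) ≤ atTop := Nat.hyperfilter_le_atTop
  have hinv : m.map hσ.measurable.aemeasurable = m := by
    refine tendsto_nhds_unique (((ProbabilityMeasure.continuous_map hσ).tendsto m).comp hm) ?_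
    simpa only [Function.comp_def, hν] using hm
  refine ⟨Ω, inferInstance, (m : Measure Ω), inferInstance, σ, F,
    ⟨hσ.measurable, congrArg Subtype.val hinv⟩, fun i => (hF i).measurable,
    fun i w => abs_le.2 (w 0 i).2, fun d hd => ?_⟩
  let g : Ω → ℝ := fun w => F 0 w * F 1 (σ^[d] w) * F 2 (σ^[2 * d] w)
  have hg : Continuous g :=
    ((hF 0).mul ((hF 1).comp (hσ.iterate d))).mul ((hF 2).comp (hσ.iterate (2 * d)))
  have hlim := ProbabilityMeasure.tendsto_iff_forall_integral_tendsto.1 hm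
    (BoundedContinuousFunction.mkOfCompact ⟨g, hg⟩)
  refine tendsto_nhds_unique hlim (((hL d hd).mono_left hle).congr fun k => ?_)
  change _ = ∫ w, g w ∂((μ k).map (φ k))
  rw [integral_map (hφ k).aemeasurable hg.aestronglyMeasurable]
  simp [g, F, hσ_iter, φ]

/-- A version of `exists_system_of_tendsto_correlation` for permutations of finite sets. -/
theorem exists_system_of_tendsto_average {X : ℕ → Type*} [∀ k, Fintype (X k)]
    [∀ k, Nonempty (X k)] (T : ∀ k, Equiv.Perm (X k)) {f : ∀ k, Fin 3 → X k → ℝ}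
    (hf1 : ∀ k i x, |f k i x| ≤ 1) {S : Set ℕ} {L : ℕ → ℝ}
    (hL : ∀ d ∈ S, Tendsto (fun k => (Fintype.card (X k) : ℝ)⁻¹ *
      ∑ x, f k 0 x * f k 1 ((T k)^[d] x) * f k 2 ((T k)^[2 * d] x)) atTop (nhds (L d))) :
    ∃ (Ω : Type) (_ : MeasurableSpace Ω) (ν : Measure Ω) (_ : IsProbabilityMeasure ν)
      (σ : Ω → Ω) (F : Fin 3 → Ω → ℝ), MeasurePreserving σ ν ν ∧ (∀ i, Measurable (F i)) ∧
      (∀ i x, |F i x| ≤ 1) ∧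
      ∀ d ∈ S, ∫ x, F 0 x * F 1 (σ^[d] x) * F 2 (σ^[2 * d] x) ∂ν = L d := by
  let _ : ∀ k, MeasurableSpace (X k) := fun _ => ⊤
  have hd : ∀ k, DiscreteMeasurableSpace (X k) := fun _ => ⟨fun _ => trivial⟩
  let μ : ∀ k, Measure (X k) := fun k => (Fintype.card (X k) : ENNReal)⁻¹ • Measure.count
  have hμ : ∀ k, IsProbabilityMeasure (μ k) := fun k => ⟨by
    simp [μ, ENNReal.inv_mul_cancel]⟩
  refine exists_system_of_tendsto_correlation μ (T := fun k => T k) (fun k => ?_)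
    (fun k i => measurable_from_top) hf1 fun d hdS => ?_
  · refine ⟨measurable_from_top, ?_⟩
    rw [Measure.map_smul]
    congr 1
    ext s hs
    rw [Measure.map_apply measurable_from_top hs, Measure.count_apply MeasurableSet.of_discrete,
      Measure.count_apply hs, ← Equiv.image_symm_eq_preimage,
      (T k).symm.injective.encard_image]
  · simpa [μ, integral_smul_measure] using hL d hdS

section MixedRadix

variable (M : ℕ → ℕ)

/-- The place value of the `k`-th digit in the mixed radix system with bases `M`. -/
def placeValue (k : ℕ) : ℕ := ∏ i ∈ Finset.range k, M i

/-- The `i`-th digit of `x` in the mixed radix system with bases `M`. -/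
def mixedDigit (i x : ℕ) : ℕ := x / placeValue M i % M i

variable {M}

theorem placeValue_succ (k : ℕ) : placeValue M (k + 1) = placeValue M k * M k :=
  Finset.prod_range_succ _ _

theorem placeValue_pos (hpos : ∀ i, 0 < M i) (k : ℕ) : 0 < placeValue M k :=
  Finset.prod_pos fun i _ => hpos i

theorem placeValue_dvd {i k : ℕ} (h : i ≤ k) : placeValue M i ∣ placeValue M k :=
  Finset.prod_dvd_prod_of_subset _ _ _ (Finset.range_mono h)

theorem mixedDigit_add_of_dvd (hpos : ∀ i, 0 < M i) {i m : ℕ} (h : placeValue M (i + 1) ∣ m)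
    (x : ℕ) : mixedDigit M i (x + m) = mixedDigit M i x := by
  obtain ⟨r, rfl⟩ := h
  rw [placeValue_succ, mul_assoc, mixedDigit, Nat.add_mul_div_left _ _ (placeValue_pos hpos i),
    Nat.add_mul_mod_self_left, mixedDigit]

theorem mixedDigit_mod (hpos : ∀ i, 0 < M i) {i k : ℕ} (h : i < k) (x : ℕ) :
    mixedDigit M i (x % placeValue M k) = mixedDigit M i x := by
  conv_rhs => rw [← Nat.mod_add_div x (placeValue M k)]
  exact (mixedDigit_add_of_dvd hpos ((placeValue_dvd h).mul_right _) _).symm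

theorem mixedDigit_of_lt {k y t : ℕ} (hy : y < placeValue M k) (ht : t < M k) :
    mixedDigit M k (y + placeValue M k * t) = t := by
  rw [mixedDigit, Nat.add_mul_div_left _ _ (by omega), Nat.div_eq_of_lt hy, zero_add,
    Nat.mod_eq_of_lt ht]

/-- Adding a place value without carrying changes a single digit. -/
theorem mixedDigit_add_placeValue (hpos : ∀ i, 0 < M i) {a x : ℕ}
    (h : mixedDigit M a x + 1 < M a) (i : ℕ) :
    mixedDigit M i (x + placeValue M a) = mixedDigit M i x + if i = a then 1 else 0 := by
  have hdiv : (x + placeValue M a) / placeValue M a = x / placeValue M a + 1 :=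
    Nat.add_div_right _ (placeValue_pos hpos a)
  rcases lt_trichotomy i a with hi | rfl | hi
  · rw [if_neg hi.ne, add_zero, mixedDigit_add_of_dvd hpos (placeValue_dvd hi)]
  · rw [if_pos rfl]
    unfold mixedDigit at h ⊢
    rw [hdiv, Nat.add_mod, Nat.mod_eq_of_lt (a := 1) (by omega), Nat.mod_eq_of_lt h]
  · rw [if_neg hi.ne', add_zero]
    have hcarry : (x + placeValue M a) / placeValue M (a + 1) = x / placeValue M (a + 1) := by
      rw [placeValue_succ, ← Nat.div_div_eq_div_mul, ← Nat.div_div_eq_div_mul, hdiv,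
        Nat.succ_div_of_not_dvd]
      intro hd
      have h0 := Nat.mod_eq_zero_of_dvd hd
      unfold mixedDigit at h
      rw [Nat.add_mod, Nat.mod_eq_of_lt (a := 1) (by omega), Nat.mod_eq_of_lt h] at h0
      omega
    obtain ⟨r, hr⟩ := placeValue_dvd (M := M) (Nat.succ_le_of_lt hi)
    rw [mixedDigit, mixedDigit, hr, ← Nat.div_div_eq_div_mul, Nat.succ_eq_add_one, hcarry,
      Nat.div_div_eq_div_mul]

theorem sum_range_mul_eq (f : ℕ → ℕ) (m n : ℕ) :
    ∑ x ∈ Finset.range (m * n), f x =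
      ∑ t ∈ Finset.range n, ∑ y ∈ Finset.range m, f (y + m * t) := by
  induction n with
  | zero => simp
  | succ n ih =>
    rw [Nat.mul_succ, Finset.sum_range_add, Finset.sum_range_succ, ih]
    simp only [add_comm]

variable (M) in
/-- The first `k` digits of `x` are so small that no carry occurs on adding `2` to each. -/
def NoCarry (k x : ℕ) : Prop := ∀ i < k, mixedDigit M i x < M i - 3

instance (k x : ℕ) : Decidable (NoCarry M k x) := by unfold NoCarry; infer_instance

theorem sum_noCarry (hpos : ∀ i, 0 < M i) (k : ℕ) :
    ∑ x ∈ Finset.range (placeValue M k), (if NoCarry M k x then 1 else 0) =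
      ∏ i ∈ Finset.range k, (M i - 3) := by
  induction k with
  | zero => simp [placeValue, NoCarry]
  | succ k ih =>
    rw [placeValue_succ, sum_range_mul_eq, Finset.prod_range_succ, ← ih]
    have hsplit : ∀ t ∈ Finset.range (M k),
        ∑ y ∈ Finset.range (placeValue M k),
          (if NoCarry M (k + 1) (y + placeValue M k * t) then 1 else 0) =
        (∑ y ∈ Finset.range (placeValue M k), if NoCarry M k y then 1 else 0) *
          if t < M k - 3 then 1 else 0 := by
      intro t ht
      rw [Finset.sum_mul]
      refine Finset.sum_congr rfl fun y hy => ?_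
      have hiff : NoCarry M (k + 1) (y + placeValue M k * t) ↔ NoCarry M k y ∧ t < M k - 3 := by
        simp only [NoCarry, Nat.forall_lt_succ_right,
          mixedDigit_of_lt (Finset.mem_range.1 hy) (Finset.mem_range.1 ht)]
        refine and_congr_left fun _ => forall₂_congr fun i hi => ?_
        rw [mixedDigit_add_of_dvd hpos ((placeValue_dvd hi).mul_right _)]
      simp only [hiff, ite_and, mul_ite, mul_one, mul_zero]
      split_ifs <;> rfl
    rw [Finset.sum_congr rfl hsplit, ← Finset.mul_sum, Finset.sum_boole]
    congr 1
    have : {t ∈ Finset.range (M k) | t < M k - 3} = Finset.range (M k - 3) := by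
      ext t; simp only [Finset.mem_filter, Finset.mem_range]; omega
    simp [this]

variable (M) in
/-- The quadratic form with strictly upper triangular coefficients `q` in the first `k` digits. -/
def digitForm (q : ℕ → ℕ → ℕ) (k x : ℕ) : ℕ :=
  ∑ i ∈ Finset.range k, ∑ j ∈ Finset.range k,
    if i < j then q i j * (mixedDigit M i x * mixedDigit M j x) else 0

theorem digitForm_mod (hpos : ∀ i, 0 < M i) (q : ℕ → ℕ → ℕ) (k x : ℕ) :
    digitForm M q k (x % placeValue M k) = digitForm M q k x :=
  Finset.sum_congr rfl fun i hi => Finset.sum_congr rfl fun j hj => by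
    rw [mixedDigit_mod hpos (Finset.mem_range.1 hi), mixedDigit_mod hpos (Finset.mem_range.1 hj)]

theorem NoCarry.mixedDigit_add (hpos : ∀ i, 0 < M i) {k a b x : ℕ} (hx : NoCarry M k x)
    (hab : a < b) (hb : b < k) (i : ℕ) :
    mixedDigit M i (x + (placeValue M a + placeValue M b)) =
        mixedDigit M i x + ((if i = a then 1 else 0) + if i = b then 1 else 0) ∧
      mixedDigit M i (x + 2 * (placeValue M a + placeValue M b)) =
        mixedDigit M i x + 2 * ((if i = a then 1 else 0) + if i = b then 1 else 0) := by
  have ha := hx a (hab.trans hb)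
  have hb := hx b hb
  have e1 := mixedDigit_add_placeValue hpos (a := a) (x := x) (by omega)
  have e2 := mixedDigit_add_placeValue hpos (a := b) (x := x + placeValue M a)
    (by rw [e1, if_neg hab.ne']; omega)
  have e3 := mixedDigit_add_placeValue hpos (a := a) (x := x + placeValue M a + placeValue M b)
    (by rw [e2, e1, if_pos rfl, if_neg hab.ne]; omega)
  have e4 := mixedDigit_add_placeValue hpos (a := b)
    (x := x + placeValue M a + placeValue M b + placeValue M a)
    (by rw [e3, e2, e1, if_pos rfl, if_neg hab.ne']; omega)
  constructor
  · rw [← add_assoc, e2, e1, add_assoc]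
  · rw [show x + 2 * (placeValue M a + placeValue M b) =
      x + placeValue M a + placeValue M b + placeValue M a + placeValue M b by ring,
      e4, e3, e2, e1]
    ring

theorem NoCarry.digitForm_add (hpos : ∀ i, 0 < M i) (q : ℕ → ℕ → ℕ) {k a b x : ℕ}
    (hx : NoCarry M k x) (hab : a < b) (hb : b < k) :
    digitForm M q k x + digitForm M q k (x + 2 * (placeValue M a + placeValue M b)) =
      2 * digitForm M q k (x + (placeValue M a + placeValue M b)) + 2 * q a b := by
  have hq : q a b = ∑ i ∈ Finset.range k, ∑ j ∈ Finset.range k,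
      if i < j then q i j * (((if i = a then 1 else 0) + if i = b then 1 else 0) *
        ((if j = a then 1 else 0) + if j = b then 1 else 0)) else 0 := by
    rw [Finset.sum_eq_single a, Finset.sum_eq_single b]
    · simp [hab, hab.ne, hab.ne']
    · intro j _ hj
      by_cases h : a < j
      · simp [hj, h.ne']
      · simp [h]
    · simp [hb]
    · intro i _ hi
      refine Finset.sum_eq_zero fun j _ => ?_
      split_ifs <;> omega
    · simp [hab.trans hb]
  rw [hq]
  simp only [digitForm, (hx.mixedDigit_add hpos hab hb _).1, (hx.mixedDigit_add hpos hab hb _).2,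
    Finset.mul_sum, ← Finset.sum_add_distrib]
  refine Finset.sum_congr rfl fun i _ => Finset.sum_congr rfl fun j _ => ?_
  by_cases h : i < j
  · simp only [h, if_true]; ring
  · simp [h]

end MixedRadix

open Complex in
theorem I_pow_re_im_mul {m n p q : ℕ} (h : m + n = 2 * p + 2 * q) :
    (((I ^ m).re * (I ^ n).re - (I ^ m).im * (I ^ n).im) * (-1) ^ p : ℝ) = (-1) ^ q := by
  have hI : I ^ m * I ^ n = (((-1) ^ p * (-1) ^ q : ℝ) : ℂ) := by
    rw [← pow_add, h, ← mul_add, pow_mul, I_sq, pow_add]; push_cast; rfl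
  rw [← mul_re, hI, ofReal_re, mul_right_comm, ← mul_pow]
  simp

open Complex in
/-- The three observables at digit data `x`, on the sheet `s`. -/
noncomputable def observable (M : ℕ → ℕ) (q : ℕ → ℕ → ℕ) (k : ℕ) : Fin 3 → ℕ → Fin 3 → ℝ
  | 0, x => if NoCarry M k x then
      ![(I ^ digitForm M q k x).re, -(I ^ digitForm M q k x).im, 1 / 2] else 0
  | 1, x => ![(-1) ^ digitForm M q k x, (-1) ^ digitForm M q k x, 1]
  | 2, x => ![(I ^ digitForm M q k x).re, (I ^ digitForm M q k x).im, 1]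

theorem abs_observable_le_one (M : ℕ → ℕ) (q : ℕ → ℕ → ℕ) (k : ℕ) (i : Fin 3) (x : ℕ)
    (s : Fin 3) : |observable M q k i x s| ≤ 1 := by
  have hre := Complex.abs_re_le_norm (Complex.I ^ digitForm M q k x)
  have him := Complex.abs_im_le_norm (Complex.I ^ digitForm M q k x)
  rw [norm_pow, Complex.norm_I, one_pow] at hre him
  have hhalf : (2 : ℝ)⁻¹ ≤ 1 := by norm_num
  fin_cases i <;> simp only [observable] <;> try split_ifs
  all_goals fin_cases s <;> simp [hre, him, hhalf]

theorem sum_observable_mul {M : ℕ → ℕ} (hpos : ∀ i, 0 < M i) (q : ℕ → ℕ → ℕ) {k a b : ℕ}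
    (hab : a < b) (hb : b < k) (x : ℕ) :
    ∑ s, observable M q k 0 x s * observable M q k 1 (x + (placeValue M a + placeValue M b)) s *
      observable M q k 2 (x + 2 * (placeValue M a + placeValue M b)) s =
    ((-1) ^ q a b + 1 / 2) * ((if NoCarry M k x then 1 else 0 : ℕ) : ℝ) := by
  by_cases hx : NoCarry M k x
  · rw [Fin.sum_univ_three, ← I_pow_re_im_mul (hx.digitForm_add hpos q hab hb)]
    simp [observable, hx]
    ring
  · simp [observable, hx]

theorem sum_zmod_val {n : ℕ} [NeZero n] (g : ℕ → ℝ) :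
    ∑ z : ZMod n, g z.val = ∑ x ∈ Finset.range n, g x := by
  cases n with
  | zero => exact absurd rfl (NeZero.ne 0)
  | succ n => exact Fin.sum_univ_eq_sum_range g (n + 1)

/-- The average of the product of the observables along a progression of difference
`placeValue M a + placeValue M b`. -/
theorem average_observable {M : ℕ → ℕ} (hpos : ∀ i, 0 < M i) (hdiv : ∀ i, 3 ∣ M i)
    (q : ℕ → ℕ → ℕ) {k a b : ℕ} [NeZero (placeValue M k)] (hab : a < b) (hb : b < k) {d : ℕ}
    (hd : d = placeValue M a + placeValue M b) :
    (Fintype.card (ZMod (placeValue M k) × Fin 3) : ℝ)⁻¹ *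
      ∑ z : ZMod (placeValue M k) × Fin 3, observable M q k 0 z.1.val z.2 *
        observable M q k 1 (z.1 + d).val z.2 *
        observable M q k 2 (z.1 + (2 * d : ℕ)).val z.2 =
    ((-1) ^ q a b + 1 / 2) / 3 * ∏ i ∈ Finset.range k, (1 - 3 / (M i : ℝ)) := by
  have hmod : ∀ x, digitForm M q k (x % placeValue M k) = digitForm M q k x :=
    digitForm_mod hpos q k
  have hval : ∀ (z : ZMod (placeValue M k)) (e : ℕ),
      digitForm M q k (z + (e : ZMod _)).val = digitForm M q k (z.val + e) := by
    intro z e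
    rw [ZMod.val_add, ZMod.val_natCast, Nat.add_mod_mod, hmod]
  have h1 : ∀ (z : ZMod (placeValue M k)) (e : ℕ),
      observable M q k 1 (z + (e : ZMod _)).val = observable M q k 1 (z.val + e) := by
    intro z e; simp only [observable, hval]
  have h2 : ∀ (z : ZMod (placeValue M k)) (e : ℕ),
      observable M q k 2 (z + (e : ZMod _)).val = observable M q k 2 (z.val + e) := by
    intro z e; simp only [observable, hval]
  simp only [Fintype.sum_prod_type, h1, h2]
  rw [sum_zmod_val fun x => ∑ s, observable M q k 0 x s * observable M q k 1 (x + d) s *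
    observable M q k 2 (x + 2 * d) s]
  simp only [hd, sum_observable_mul hpos q hab hb]
  rw [← Finset.mul_sum, ← Nat.cast_sum, sum_noCarry hpos k]
  have hM : ∀ i, (1 - 3 / (M i : ℝ)) = ((M i - 3 : ℕ) : ℝ) / M i := by
    intro i
    have h0 : (M i : ℝ) ≠ 0 := by exact_mod_cast (hpos i).ne'
    rw [Nat.cast_sub (Nat.le_of_dvd (hpos i) (hdiv i))]
    field_simp
    norm_num
  rw [Fintype.card_prod, ZMod.card, Fintype.card_fin]
  simp only [hM, Finset.prod_div_distrib, placeValue]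
  push_cast
  field_simp

/-- Equation (5.1) of the paper (after rescaling): for every
`η : 𝒮 → {1, −1/3}` there is a probability measure-preserving system
`(X, μ, T)` and bounded measurable `F₀, F₁, F₂ : X → ℝ` with
`∫ F₀ · (F₁ ∘ T^d) · (F₂ ∘ T^{2d}) dμ = η(d)` for every `d ∈ 𝒮`.
Sequences are 0-indexed: `M i` stands for `M_{i+1}`, `N k = M_1 ⋯ M_k`. -/
theorem stmt_14 (M : ℕ → ℕ) (hmono : StrictMono M) (hpos : ∀ i, 0 < M i)
    (hdiv : ∀ i, 3 ∣ M i)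
    (hlog : Tendsto (fun k : ℕ => (∑ i ∈ Finset.range k, Real.log (M i)) / (k : ℝ) ^ 2)
      atTop (nhds 0))
    (γ : ℝ) (hγ : 0 < γ)
    (hprod : Tendsto (fun k : ℕ => ∏ i ∈ Finset.range k, (1 - 3 / (M i : ℝ)))
      atTop (nhds γ))
    (N : ℕ → ℕ) (hN : ∀ k, N k = ∏ i ∈ Finset.range k, M i)
    (S : Set ℕ) (hS : S = {n | ∃ a b : ℕ, a < b ∧ n = N a + N b})
    (η : ℕ → ℝ) (hη : ∀ n ∈ S, η n = 1 ∨ η n = -1/3) :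
    ∃ (X : Type) (_ : MeasurableSpace X) (μ : Measure X)
      (_ : IsProbabilityMeasure μ) (T : X → X) (F₀ F₁ F₂ : X → ℝ),
      MeasurePreserving T μ μ ∧
      Measurable F₀ ∧ Measurable F₁ ∧ Measurable F₂ ∧
      (∃ c : ℝ, ∀ x, |F₀ x| ≤ c) ∧ (∃ c : ℝ, ∀ x, |F₁ x| ≤ c) ∧
      (∃ c : ℝ, ∀ x, |F₂ x| ≤ c) ∧
      ∀ d ∈ S, ∫ x, F₀ x * F₁ (T^[d] x) * F₂ (T^[2 * d] x) ∂μ = η d := by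
  classical
  obtain rfl : N = placeValue M := funext hN
  have hne : ∀ k, NeZero (placeValue M k) := fun k => ⟨(placeValue_pos hpos k).ne'⟩
  let q : ℕ → ℕ → ℕ := fun a b => if η (placeValue M a + placeValue M b) = 1 then 0 else 1
  let T : ∀ k, Equiv.Perm (ZMod (placeValue M k) × Fin 3) := fun k =>
    (Equiv.addRight 1).prodCongr (Equiv.refl _)
  have hT : ∀ k d z, (T k)^[d] z = (z.1 + (d : ZMod (placeValue M k)), z.2) := by
    intro k d z
    induction d with
    | zero => simp
    | succ d ih => rw [Function.iterate_succ_apply', ih]; simp [T, add_assoc]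
  obtain ⟨X, mX, μ, hμ, σ, F, hσ, hF, hF1, hint⟩ :=
    exists_system_of_tendsto_average T (f := fun k i z => observable M q k i z.1.val z.2)
      (fun k i z => abs_observable_le_one M q k i _ _) (S := S)
      (L := fun d => η d / 2 * γ) (by
        intro d hd
        have hηd := hη d hd
        rw [hS] at hd
        obtain ⟨a, b, hab, rfl⟩ := hd
        refine (hprod.const_mul _).congr' ?_
        filter_upwards [eventually_gt_atTop b] with k hk
        simp only [hT]
        rw [average_observable hpos hdiv q hab hk rfl]
        congr 1
        rcases hηd with h | h
        · simp only [q, h, if_true]; norm_num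
        · simp only [q, h]; norm_num)
  refine ⟨X, mX, μ, hμ, σ, fun x => 2 / γ * F 0 x, F 1, F 2, hσ, (hF 0).const_mul _, hF 1, hF 2,
    ⟨2 / γ, fun x => ?_⟩, ⟨1, hF1 1⟩, ⟨1, hF1 2⟩, fun d hd => ?_⟩
  · rw [abs_mul, abs_of_pos (div_pos two_pos hγ)]
    exact mul_le_of_le_one_right (div_pos two_pos hγ).le (hF1 0 x)
  · simp only [mul_assoc]
    rw [integral_const_mul]
    simp only [← mul_assoc]
    rw [hint d hd]
    field_simp
end

section
/- Let M_1 < M_2 < ⋯ be a strictly increasing sequence of positive integers and set N_k := M_1 M_2 ⋯ M_k. Then the series θ := ∑_{k=1}^∞ 1/N_k converges and θ is irrational. -/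
/-- Partial products of a monotone sequence grow at least geometrically. -/
theorem prod_range_mul_pow_le_prod_range_add {M : ℕ → ℕ} (hmono : Monotone M) (k j : ℕ) :
    (∏ i ∈ Finset.range k, M i) * M k ^ j ≤ ∏ i ∈ Finset.range (k + j), M i := by
  rw [Finset.prod_range_add]
  gcongr
  simpa using Finset.pow_card_le_prod (Finset.range j) (fun i => M (k + i)) (M k)
    fun i _ => hmono (Nat.le_add_right k i)

theorem one_div_prod_range_add_le {M : ℕ → ℕ} (hpos : ∀ i, 0 < M i) (hmono : Monotone M)
    (k j : ℕ) :
    (1 : ℝ) / (∏ i ∈ Finset.range (j + k + 1), M i : ℕ) ≤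
      1 / (∏ i ∈ Finset.range k, M i : ℕ) * (1 / M k) * (1 / M k : ℝ) ^ j := by
  have hP : 0 < ∏ i ∈ Finset.range k, M i := Finset.prod_pos fun i _ => hpos i
  have hM := hpos k
  have h := prod_range_mul_pow_le_prod_range_add hmono k (j + 1)
  rw [show k + (j + 1) = j + k + 1 by ring] at h
  calc (1 : ℝ) / (∏ i ∈ Finset.range (j + k + 1), M i : ℕ)
      ≤ 1 / ((∏ i ∈ Finset.range k, M i) * M k ^ (j + 1) : ℕ) := by
        apply one_div_le_one_div_of_le
        · exact_mod_cast Nat.mul_pos hP (pow_pos hM _)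
        · exact_mod_cast h
    _ = _ := by
        push_cast
        rw [one_div_pow, pow_succ', one_div_mul_one_div, one_div_mul_one_div, mul_assoc]

theorem summable_one_div_prod_range {M : ℕ → ℕ} (hpos : ∀ i, 0 < M i) (hmono : StrictMono M) :
    Summable fun k : ℕ => (1 : ℝ) / (∏ i ∈ Finset.range (k + 1), M i : ℕ) := by
  rw [← summable_nat_add_iff 1]
  have h1 : 0 < M 1 := hpos 1
  have h2 : 1 < M 1 := lt_of_le_of_lt (hpos 0) (hmono one_pos)
  refine Summable.of_nonneg_of_le (fun j => by positivity)
    (fun j => one_div_prod_range_add_le hpos hmono.monotone 1 j) (Summable.mul_left _ ?_)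
  refine summable_geometric_of_lt_one (by positivity) ?_
  rw [div_lt_one (by positivity)]
  exact_mod_cast h2

theorem tsum_one_div_prod_range_tail_le {M : ℕ → ℕ} (hpos : ∀ i, 0 < M i)
    (hmono : StrictMono M) {k : ℕ} (hk : 1 < M k) :
    ∑' j : ℕ, (1 : ℝ) / (∏ i ∈ Finset.range (j + k + 1), M i : ℕ) ≤
      1 / ((∏ i ∈ Finset.range k, M i : ℕ) * ((M k : ℝ) - 1)) := by
  have hk' : (1 : ℝ) < M k := by exact_mod_cast hk
  have hP : (0 : ℝ) < (∏ i ∈ Finset.range k, M i : ℕ) := by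
    exact_mod_cast Finset.prod_pos fun i _ => hpos i
  have hr : (1 / M k : ℝ) < 1 := by
    rw [div_lt_one (by positivity)]
    exact hk'
  have hgeom := (hasSum_geometric_of_lt_one (by positivity) hr).mul_left
    (1 / (∏ i ∈ Finset.range k, M i : ℕ) * (1 / M k : ℝ))
  have hsum := (summable_nat_add_iff k).2 (summable_one_div_prod_range hpos hmono)
  refine (hsum.tsum_le_tsum (one_div_prod_range_add_le hpos hmono.monotone k)
    hgeom.summable).trans_eq ?_
  rw [hgeom.tsum_eq]
  have h1 : (M k : ℝ) - 1 ≠ 0 := by linarith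
  have h0 : (M k : ℝ) ≠ 0 := by positivity
  field_simp

theorem exists_nat_eq_prod_mul_sum_one_div {M : ℕ → ℕ} (hpos : ∀ i, 0 < M i) (k : ℕ) :
    ∃ a : ℕ, (a : ℝ) = (∏ i ∈ Finset.range k, M i : ℕ) *
      ∑ j ∈ Finset.range k, (1 : ℝ) / (∏ i ∈ Finset.range (j + 1), M i : ℕ) := by
  refine ⟨∑ j ∈ Finset.range k,
    (∏ i ∈ Finset.range k, M i) / (∏ i ∈ Finset.range (j + 1), M i), ?_⟩
  rw [Finset.mul_sum, Nat.cast_sum]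
  refine Finset.sum_congr rfl fun j hj => ?_
  have hne : ((∏ i ∈ Finset.range (j + 1), M i : ℕ) : ℝ) ≠ 0 := by
    exact_mod_cast (Finset.prod_pos fun i _ => hpos i).ne'
  rw [Nat.cast_div (Finset.prod_dvd_prod_of_subset _ _ _
    (Finset.range_mono (Finset.mem_range.1 hj))) hne, mul_one_div]

/-- For a strictly increasing sequence of positive integers `M_1 < M_2 < ⋯`
(0-indexed as `M 0 < M 1 < ⋯`) with partial products `N k = M_1 ⋯ M_k`, the
series `θ = ∑_{k ≥ 1} 1/N_k` converges and `θ` is irrational. -/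
theorem stmt_16 (M : ℕ → ℕ) (hpos : ∀ i, 0 < M i) (hmono : StrictMono M)
    (N : ℕ → ℕ) (hN : ∀ k, N k = ∏ i ∈ Finset.range k, M i) :
    Summable (fun k : ℕ => (1 : ℝ) / N (k + 1)) ∧
      Irrational (∑' k : ℕ, (1 : ℝ) / N (k + 1)) := by
  have hNpos : ∀ k, 0 < N k := fun k => hN k ▸ Finset.prod_pos fun i _ => hpos i
  have hsum : Summable (fun k : ℕ => (1 : ℝ) / N (k + 1)) := by
    simpa only [hN] using summable_one_div_prod_range hpos hmono
  refine ⟨hsum, ?_⟩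
  rintro ⟨r, hr⟩
  obtain ⟨k, hk⟩ : ∃ k, r.den + 1 < M k := ⟨r.den + 2, hmono.le_apply⟩
  obtain ⟨a, ha⟩ := exists_nat_eq_prod_mul_sum_one_div hpos k
  have htail := tsum_one_div_prod_range_tail_le hpos hmono (k := k) (by omega)
  simp only [← hN] at ha htail
  have hsplit := hsum.sum_add_tsum_nat_add k
  have htail_pos : 0 < ∑' j : ℕ, (1 : ℝ) / N (j + k + 1) :=
    ((summable_nat_add_iff k).2 hsum).tsum_pos (fun j => by positivity) 0
      (one_div_pos.2 (Nat.cast_pos.2 (hNpos _)))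
  set T := ∑' j : ℕ, (1 : ℝ) / N (j + k + 1)
  have hNk : (0 : ℝ) < N k := Nat.cast_pos.2 (hNpos k)
  have hq : (0 : ℝ) < r.den := Nat.cast_pos.2 r.den_pos
  have hk' : (r.den : ℝ) + 1 < M k := by exact_mod_cast hk
  have hr' : (r : ℝ) * r.den = r.num := by exact_mod_cast Rat.mul_den_eq_num r
  have hint : ((r.num * N k - r.den * a : ℤ) : ℝ) = r.den * (N k * T) := by
    push_cast
    rw [ha, ← hr', hr, ← hsplit]
    ring
  have hlt : r.den * (N k * T) < 1 := by
    have h1 : (0 : ℝ) < M k - 1 := by linarith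
    rw [le_div_iff₀ (by positivity)] at htail
    have h2 : 0 < N k * T := by positivity
    nlinarith
  have hgt : 0 < r.den * (N k * T) := by positivity
  rw [← hint] at hlt hgt
  have hlt' : r.num * N k - r.den * a < (1 : ℤ) := by exact_mod_cast hlt
  have hgt' : (0 : ℤ) < r.num * N k - r.den * a := by exact_mod_cast hgt
  omega
end

section
/- Let θ := ∑_{k=1}^∞ 1/N_k. Then for every ε > 0 there exist finitely many open arcs in ℝ/ℤ of total length less than ε whose union contains the set {θ n mod 1 : n ∈ 𝒮}. In particular, the closure of {θ n mod 1 : n ∈ 𝒮} in ℝ/ℤ has Haar (Lebesgue) measure zero. -/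
open Filter MeasureTheory

/-- A countable compact subset of a metric space is covered by finitely many balls of arbitrarily
small total length. -/
theorem IsCompact.exists_finite_cover_ball_of_countable {X : Type*} [PseudoMetricSpace X]
    {K : Set X} (hK : IsCompact K) (hc : K.Countable) {ε : ℝ} (hε : 0 < ε) :
    ∃ (m : ℕ) (c : Fin m → X) (r : Fin m → ℝ), (∀ i, 0 < r i) ∧ (∑ i : Fin m, 2 * r i) < ε ∧
      K ⊆ ⋃ i : Fin m, Metric.ball (c i) (r i) := by
  rcases K.eq_empty_or_nonempty with rfl | hne
  · exact ⟨0, Fin.elim0, Fin.elim0, fun i => i.elim0, by simpa using hε, Set.empty_subset _⟩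
  obtain ⟨y, rfl⟩ := hc.exists_eq_range hne
  let r : ℕ → ℝ := fun n => ε / 4 / 2 / 2 ^ n
  have hr : ∀ n, 0 < r n := fun n => by positivity
  have hsum : HasSum r (ε / 4) := hasSum_geometric_two' (ε / 4)
  obtain ⟨t, ht⟩ := hK.elim_finite_subcover (fun n => Metric.ball (y n) (r n))
    (fun n => Metric.isOpen_ball) (by
      rintro _ ⟨n, rfl⟩
      exact Set.mem_iUnion.2 ⟨n, Metric.mem_ball_self (hr n)⟩)
  let e := t.equivFin
  refine ⟨t.card, fun i => y (e.symm i), fun i => r (e.symm i), fun i => hr _, ?_, ?_⟩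
  · have h1 : ∑ i : Fin t.card, 2 * r (e.symm i) = 2 * ∑ n ∈ t, r n := by
      rw [← Finset.mul_sum, e.symm.sum_comp (fun n : t => r n), Finset.sum_coe_sort t r]
    have h2 : ∑ n ∈ t, r n ≤ ε / 4 := sum_le_hasSum t (fun n _ => (hr n).le) hsum
    linarith
  · intro x hx
    obtain ⟨n, hn, hxn⟩ := Set.mem_iUnion₂.1 (ht hx)
    refine Set.mem_iUnion.2 ⟨e ⟨n, hn⟩, ?_⟩
    simpa using hxn

/-- If `M i ≥ 2` tends to infinity and `N k = M 0 ⋯ M (k - 1)`, then the multiples by `N a` of the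
Cantor series `∑ 1 / N (k + 1)` tend to `0` modulo `1`. -/
theorem tendsto_tsum_inv_prod_mul_prod_addCircle {M N : ℕ → ℕ} (hM : ∀ i, 2 ≤ M i)
    (hlim : Tendsto M atTop atTop) (hN : ∀ k, N k = ∏ i ∈ Finset.range k, M i) :
    Tendsto (fun a => (((∑' k : ℕ, (1 : ℝ) / N (k + 1)) * N a : ℝ) : AddCircle (1 : ℝ)))
      atTop (nhds 0) := by
  have hpos : ∀ i, (0 : ℝ) < M i := fun i => by
    have := hM i
    exact_mod_cast (by omega : 0 < M i)
  have hsucc : ∀ k, (N (k + 1) : ℝ) = N k * M k := fun k => by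
    rw [hN, hN, Finset.prod_range_succ]; push_cast; rfl
  have hNpos : ∀ k, (0 : ℝ) < N k := fun k => by
    rw [hN]; push_cast; exact Finset.prod_pos fun i _ => hpos i
  have hge : ∀ a k, (N a : ℝ) * M a * 2 ^ k ≤ N (k + a + 1) := by
    intro a k
    induction k with
    | zero => simp [hsucc]
    | succ k ih =>
      rw [show k + 1 + a + 1 = (k + a + 1) + 1 by ring, hsucc, pow_succ, ← mul_assoc]
      have : (2 : ℝ) ≤ M (k + a + 1) := by exact_mod_cast hM _
      exact mul_le_mul ih this (by norm_num) (hNpos _).le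
  have hterm : ∀ a k, (1 : ℝ) / N (k + a + 1) * N a ≤ 2 / M a / 2 / 2 ^ k := by
    intro a k
    have h := hge a k
    have := hpos a
    have := hNpos a
    calc (1 : ℝ) / N (k + a + 1) * N a ≤ 1 / (N a * M a * 2 ^ k) * N a := by gcongr
      _ = _ := by field_simp
  have hgeom : ∀ a, HasSum (fun k : ℕ => (2 : ℝ) / M a / 2 / 2 ^ k) (2 / M a) :=
    fun a => hasSum_geometric_two' _
  have hnonneg : ∀ a k, 0 ≤ (1 : ℝ) / N (k + a + 1) * N a := fun a k => by positivity
  have htail : ∀ a, Summable fun k => (1 : ℝ) / N (k + a + 1) * N a := fun a =>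
    (hgeom a).summable.of_nonneg_of_le (hnonneg a) (hterm a)
  have hs : Summable fun k => (1 : ℝ) / N (k + 1) := by
    simpa [hN 0] using htail 0
  let δ : ℕ → ℝ := fun a => ∑' k, (1 : ℝ) / N (k + a + 1) * N a
  have hδ : Tendsto δ atTop (nhds 0) := by
    have hup : Tendsto (fun a => (2 : ℝ) / M a) atTop (nhds 0) :=
      (tendsto_natCast_atTop_atTop.comp hlim).const_div_atTop 2
    refine squeeze_zero (fun a => tsum_nonneg (hnonneg a)) (fun a => ?_) hup
    rw [← (hgeom a).tsum_eq]
    exact (htail a).tsum_le_tsum (hterm a) (hgeom a).summable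
  have hcoe : Tendsto (fun a => ((δ a : ℝ) : AddCircle (1 : ℝ))) atTop (nhds 0) := by
    exact ((AddCircle.continuous_mk' (1 : ℝ)).tendsto 0).comp hδ
  refine hcoe.congr fun a => ?_
  have hint : (∑ k ∈ Finset.range a, (1 : ℝ) / N (k + 1)) * N a
      = ((∑ k ∈ Finset.range a, N a / N (k + 1) : ℕ) : ℝ) := by
    rw [Finset.sum_mul]
    push_cast
    refine Finset.sum_congr rfl fun k hk => ?_
    have hdvd : N (k + 1) ∣ N a := by
      rw [hN, hN]
      exact Finset.prod_dvd_prod_of_subset _ _ _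
        (Finset.range_mono (Nat.succ_le_of_lt (Finset.mem_range.1 hk)))
    rw [Nat.cast_div hdvd (hNpos _).ne']
    ring
  have hsplit : (∑' k : ℕ, (1 : ℝ) / N (k + 1)) * N a
      = ((∑ k ∈ Finset.range a, N a / N (k + 1) : ℕ) : ℝ) + δ a := by
    rw [← hint, ← hs.sum_add_tsum_nat_add a, add_mul, ← tsum_mul_right]
  rw [hsplit, AddCircle.coe_add, right_eq_add]
  exact (AddCircle.coe_eq_zero_iff (1 : ℝ)).2
    ⟨((∑ k ∈ Finset.range a, N a / N (k + 1) : ℕ) : ℤ), by rw [zsmul_one, Int.cast_natCast]⟩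

/-- With `θ = ∑_{k ≥ 1} 1/N_k`: for every `ε > 0` the set
`{θn mod 1 : n ∈ 𝒮} ⊆ ℝ/ℤ` is covered by finitely many open arcs (metric balls)
of total length `< ε`; in particular its closure has Haar (Lebesgue) measure
zero. Sequences are 0-indexed: `M i` stands for `M_{i+1}`, `N k = M_1 ⋯ M_k`. -/
theorem stmt_18 (M : ℕ → ℕ) (hmono : StrictMono M) (hpos : ∀ i, 0 < M i)
    (hdiv : ∀ i, 3 ∣ M i)
    (hlog : Tendsto (fun k : ℕ => (∑ i ∈ Finset.range k, Real.log (M i)) / (k : ℝ) ^ 2)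
      atTop (nhds 0))
    (γ : ℝ) (hγ : 0 < γ)
    (hprod : Tendsto (fun k : ℕ => ∏ i ∈ Finset.range k, (1 - 3 / (M i : ℝ)))
      atTop (nhds γ))
    (N : ℕ → ℕ) (hN : ∀ k, N k = ∏ i ∈ Finset.range k, M i)
    (S : Set ℕ) (hS : S = {n | ∃ a b : ℕ, a < b ∧ n = N a + N b})
    (θ : ℝ) (hθ : θ = ∑' k : ℕ, (1 : ℝ) / N (k + 1)) :
    (∀ ε : ℝ, 0 < ε → ∃ (m : ℕ) (c : Fin m → AddCircle (1 : ℝ)) (r : Fin m → ℝ),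
      (∀ i, 0 < r i) ∧ (∑ i : Fin m, 2 * r i) < ε ∧
      (fun n : ℕ => ((θ * n : ℝ) : AddCircle (1 : ℝ))) '' S ⊆
        ⋃ i : Fin m, Metric.ball (c i) (r i)) ∧
    volume (closure ((fun n : ℕ => ((θ * n : ℝ) : AddCircle (1 : ℝ))) '' S)) = 0 := by
  have hM : ∀ i, 2 ≤ M i := fun i => by
    have := Nat.le_of_dvd (hpos i) (hdiv i)
    omega
  have hlim := tendsto_tsum_inv_prod_mul_prod_addCircle hM hmono.tendsto_atTop hN
  rw [← hθ] at hlim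
  let x : ℕ → AddCircle (1 : ℝ) := fun a => ((θ * N a : ℝ) : AddCircle (1 : ℝ))
  let T : Set (AddCircle (1 : ℝ)) := insert 0 (Set.range x)
  let K : Set (AddCircle (1 : ℝ)) := Set.image2 (· + ·) T T
  have hT : IsCompact T := hlim.isCompact_insert_range
  have hTc : T.Countable := (Set.countable_range x).insert 0
  have hK : IsCompact K := by
    rw [show K = _ from (Set.image_prod (· + ·)).symm]
    exact (hT.prod hT).image continuous_add
  have hKc : K.Countable := hTc.image2 hTc _
  have hsub : (fun n : ℕ => ((θ * n : ℝ) : AddCircle (1 : ℝ))) '' S ⊆ K := by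
    rintro _ ⟨n, hn, rfl⟩
    rw [hS] at hn
    obtain ⟨a, b, -, rfl⟩ := hn
    refine ⟨x a, Or.inr ⟨a, rfl⟩, x b, Or.inr ⟨b, rfl⟩, ?_⟩
    simp only [x, Nat.cast_add, mul_add, AddCircle.coe_add]
  refine ⟨fun ε hε => ?_, ?_⟩
  · obtain ⟨m, c, r, hr, hlt, hcov⟩ := hK.exists_finite_cover_ball_of_countable hKc hε
    exact ⟨m, c, r, hr, hlt, hsub.trans hcov⟩
  · have : NullSingletonClass (volume : Measure (AddCircle (1 : ℝ))) :=
      ⟨fun y => by rw [← Metric.closedBall_zero, AddCircle.volume_closedBall]; simp⟩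
    exact measure_mono_null (closure_minimal hsub hK.isClosed) (hKc.measure_zero volume)
end

section
/- There exists an irrational real number θ such that the following holds: for every function η : 𝒮 → [−1, 1] there exists a function φ : ℝ/ℤ → [−1, 1] which is continuous at Haar-almost every point of ℝ/ℤ (hence bounded and Riemann-integrable) and satisfies φ(θ n mod 1) = η(n) for all n ∈ 𝒮. -/
open Filter MeasureTheory

/-- The partial products of a sequence of integers `≥ 2` grow at least geometrically. -/
lemma prod_range_mul_two_pow_le (M : ℕ → ℕ) (hM : ∀ i, 2 ≤ M i) (b j : ℕ) :
    (∏ i ∈ Finset.range b, M i) * 2 ^ j ≤ ∏ i ∈ Finset.range (b + j), M i := by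
  induction j with
  | zero => simp
  | succ j ih =>
    rw [← add_assoc, Finset.prod_range_succ, pow_succ, ← mul_assoc]
    exact Nat.mul_le_mul ih (hM _)

/-- If `M i → ∞`, the Cantor series `θ = ∑ 1 / (M 0 ⋯ M (i - 1))` multiplied by a partial product
is an integer plus a small positive remainder. -/
lemma exists_int_add_small_mul_prod (M : ℕ → ℕ) (hmono : StrictMono M) (hM : ∀ i, 2 ≤ M i) :
    ∃ θ : ℝ, ∃ r : ℕ → ℝ, Tendsto r atTop (nhds 0) ∧ (∀ b, 0 < r b) ∧
      ∀ b, ∃ z : ℤ, θ * ((∏ i ∈ Finset.range b, M i : ℕ) : ℝ) = z + r b := by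
  set N : ℕ → ℕ := fun k => ∏ i ∈ Finset.range k, M i with hN
  have hNpos : ∀ k, (0 : ℝ) < N k := fun k => by
    exact_mod_cast Finset.prod_pos fun i _ => lt_of_lt_of_le two_pos (hM i)
  have hgrow : ∀ b j, (N b : ℝ) * 2 ^ j ≤ N (b + j) := fun b j => by
    exact_mod_cast prod_range_mul_two_pow_le M hM b j
  have hle : ∀ b j, (1 : ℝ) / N (j + b) ≤ 1 / N b * (1 / 2) ^ j := fun b j => by
    rw [add_comm, one_div_pow, one_div_mul_one_div]
    exact one_div_le_one_div_of_le (mul_pos (hNpos b) (by positivity)) (hgrow b j)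
  have hgeom : ∀ b, Summable fun j : ℕ => 1 / (N b : ℝ) * (1 / 2) ^ j := fun b =>
    summable_geometric_two.mul_left _
  have hsum : Summable fun i => (1 : ℝ) / N i :=
    Summable.of_nonneg_of_le (fun i => (one_div_pos.2 (hNpos i)).le) (fun i => hle 0 i) (hgeom 0)
  have htail : ∀ b, Summable fun j => (1 : ℝ) / N (j + b) := fun b =>
    (summable_nat_add_iff b).2 hsum
  refine ⟨∑' i, 1 / (N i : ℝ), fun b => N b * ∑' j, 1 / (N (j + (b + 1)) : ℝ), ?_, ?_, ?_⟩
  · have hbound : ∀ b, (N b : ℝ) * ∑' j, 1 / (N (j + (b + 1)) : ℝ) ≤ 2 * (1 / ((b : ℝ) + 1)) := by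
      intro b
      have h1 : ∑' j, 1 / (N (j + (b + 1)) : ℝ) ≤ 1 / N (b + 1) * 2 := by
        rw [← tsum_geometric_two, ← tsum_mul_left]
        exact (htail _).tsum_le_tsum (hle (b + 1)) (hgeom _)
      have h2 : (N (b + 1) : ℝ) = N b * M b := by
        simp [hN, Finset.prod_range_succ]
      have h3 : (b : ℝ) + 1 ≤ M b := by
        have : ∀ b, b + 1 ≤ M b := fun b => by
          induction b with
          | zero => exact le_trans (by norm_num) (hM 0)
          | succ b ih => exact Nat.succ_le_of_lt (lt_of_le_of_lt ih (hmono b.lt_succ_self))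
        exact_mod_cast this b
      have hb : (0 : ℝ) < (b : ℝ) + 1 := by positivity
      calc (N b : ℝ) * ∑' j, 1 / (N (j + (b + 1)) : ℝ) ≤ N b * (1 / N (b + 1) * 2) :=
            mul_le_mul_of_nonneg_left h1 (hNpos b).le
        _ = 2 * (1 / M b) := by
            have := (hNpos b).ne'
            have := (hb.trans_le h3).ne'
            rw [h2]; field_simp
        _ ≤ _ := mul_le_mul_of_nonneg_left (one_div_le_one_div_of_le hb h3) two_pos.le
    refine squeeze_zero (fun b => mul_nonneg (hNpos b).le
      (tsum_nonneg fun j => (one_div_pos.2 (hNpos _)).le)) hbound ?_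
    simpa using (tendsto_one_div_add_atTop_nhds_zero_nat (𝕜 := ℝ)).const_mul 2
  · intro b
    exact mul_pos (hNpos b) ((htail _).tsum_pos (fun j => (one_div_pos.2 (hNpos _)).le) 0
      (one_div_pos.2 (hNpos _)))
  · intro b
    have hdvd : ∀ i ∈ Finset.range (b + 1), (N b : ℝ) * (1 / N i) = ((N b / N i : ℕ) : ℝ) := by
      intro i hi
      have : N i ∣ N b := Finset.prod_dvd_prod_of_subset _ _ _
        (Finset.range_subset_range.2 (Nat.lt_succ_iff.1 (Finset.mem_range.1 hi)))
      rw [Nat.cast_div this (hNpos i).ne', mul_one_div]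
    refine ⟨((∑ i ∈ Finset.range (b + 1), N b / N i : ℕ) : ℤ), ?_⟩
    change (∑' i, 1 / (N i : ℝ)) * N b = _
    rw [← hsum.sum_add_tsum_nat_add (b + 1), add_mul, mul_comm, Finset.mul_sum,
      Finset.sum_congr rfl hdvd, mul_comm (∑' _, _)]
    push_cast
    rfl

/-- A real number having multiples arbitrarily close to, but different from, integers is
irrational. -/
lemma irrational_of_mul_eq_int_add_small (θ : ℝ) (N : ℕ → ℕ) (r : ℕ → ℝ)
    (hr : Tendsto r atTop (nhds 0)) (hpos : ∀ b, 0 < r b)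
    (hθ : ∀ b, ∃ z : ℤ, θ * N b = z + r b) : Irrational θ := by
  rintro ⟨q, rfl⟩
  have hden : (0 : ℝ) < q.den := by exact_mod_cast q.den_pos
  obtain ⟨b, hb⟩ := (hr.eventually (gt_mem_nhds (one_div_pos.2 hden))).exists
  obtain ⟨z, hz⟩ := hθ b
  have hq : (q : ℝ) * q.den = q.num := by exact_mod_cast q.mul_den_eq_num
  have hint : ((q.num * N b - q.den * z : ℤ) : ℝ) = q.den * r b := by
    push_cast
    linear_combination (-(N b : ℝ)) * hq + (q.den : ℝ) * hz
  have h0 : (0 : ℝ) < q.den * r b := mul_pos hden (hpos b)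
  have h1 : q.den * r b < 1 := by rwa [lt_div_iff₀' hden] at hb
  rw [← hint] at h0 h1
  have h0' : 0 < q.num * N b - q.den * z := by exact_mod_cast h0
  have h1' : q.num * N b - q.den * z < 1 := by exact_mod_cast h1
  omega

/-- The multiples of an irrational number are pairwise distinct modulo one. -/
lemma injective_natCast_mul_addCircle {θ : ℝ} (hθ : Irrational θ) :
    Function.Injective fun n : ℕ => ((θ * n : ℝ) : AddCircle (1 : ℝ)) := by
  intro m n h
  rw [← sub_eq_zero, ← AddCircle.coe_sub, AddCircle.coe_eq_zero_iff] at h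
  obtain ⟨k, hk⟩ := h
  by_contra hmn
  have hne : (m : ℤ) - n ≠ 0 := sub_ne_zero.2 (by exact_mod_cast hmn)
  refine (hθ.mul_intCast hne).ne_int k ?_
  push_cast
  rw [mul_sub, ← hk, zsmul_one]

/-- Arbitrary values in `[-1, 1]` prescribed on a set with countable closure extend to a function
that is continuous almost everywhere. -/
lemma exists_ae_continuousAt_extension {ι X : Type*} [TopologicalSpace X] [MeasurableSpace X]
    (μ : Measure X) [NullSingletonClass μ] {f : ι → X} (hf : Function.Injective f) {S : Set ι} {C : Set X}
    (hC : IsClosed C) (hCc : C.Countable) (hSC : ∀ i ∈ S, f i ∈ C) (η : ι → ℝ)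
    (hη : ∀ i ∈ S, η i ∈ Set.Icc (-1 : ℝ) 1) :
    ∃ φ : X → ℝ, (∀ y, φ y ∈ Set.Icc (-1 : ℝ) 1) ∧ (∀ᵐ y ∂μ, ContinuousAt φ y) ∧
      ∀ i ∈ S, φ (f i) = η i := by
  have hval : ∀ i ∈ S, Function.extend f (S.indicator η) 0 (f i) = η i := fun i hi => by
    rw [hf.extend_apply, Set.indicator_of_mem hi]
  have hzero : ∀ y, (∀ i ∈ S, f i ≠ y) → Function.extend f (S.indicator η) 0 y = 0 := by
    intro y hy
    by_cases h : ∃ i, f i = y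
    · obtain ⟨i, rfl⟩ := h
      rw [hf.extend_apply, Set.indicator_of_notMem fun hi => hy i hi rfl]
    · rw [Function.extend_apply' _ _ _ h, Pi.zero_apply]
  refine ⟨Function.extend f (S.indicator η) 0, fun y => ?_, ?_, hval⟩
  · by_cases h : ∀ i ∈ S, f i ≠ y
    · rw [hzero y h]; norm_num
    · push Not at h
      obtain ⟨i, hi, rfl⟩ := h
      rw [hval i hi]
      exact hη i hi
  · filter_upwards [hCc.ae_notMem μ] with y hy
    refine (continuousAt_const (y := (0 : ℝ))).congr ?_
    filter_upwards [hC.isOpen_compl.mem_nhds hy] with x hx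
    exact (hzero x fun i hi h => hx (h ▸ hSC i hi)).symm

/-- Proposition A.1: there is an irrational `θ` such that for every
`η : 𝒮 → [−1,1]` there is a function `φ : ℝ/ℤ → [−1,1]`, continuous at
Haar-almost every point (hence bounded and Riemann-integrable), with
`φ(θn) = η(n)` for all `n ∈ 𝒮`.
Sequences are 0-indexed: `M i` stands for `M_{i+1}`, `N k = M_1 ⋯ M_k`. -/
theorem stmt_19 (M : ℕ → ℕ) (hmono : StrictMono M) (hpos : ∀ i, 0 < M i)
    (hdiv : ∀ i, 3 ∣ M i)
    (hlog : Tendsto (fun k : ℕ => (∑ i ∈ Finset.range k, Real.log (M i)) / (k : ℝ) ^ 2)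
      atTop (nhds 0))
    (γ : ℝ) (hγ : 0 < γ)
    (hprod : Tendsto (fun k : ℕ => ∏ i ∈ Finset.range k, (1 - 3 / (M i : ℝ)))
      atTop (nhds γ))
    (N : ℕ → ℕ) (hN : ∀ k, N k = ∏ i ∈ Finset.range k, M i)
    (S : Set ℕ) (hS : S = {n | ∃ a b : ℕ, a < b ∧ n = N a + N b}) :
    ∃ θ : ℝ, Irrational θ ∧
      ∀ η : ℕ → ℝ, (∀ n ∈ S, η n ∈ Set.Icc (-1 : ℝ) 1) →
        ∃ φ : AddCircle (1 : ℝ) → ℝ,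
          (∀ y, φ y ∈ Set.Icc (-1 : ℝ) 1) ∧
          (∀ᵐ y : AddCircle (1 : ℝ), ContinuousAt φ y) ∧
          ∀ n ∈ S, φ ((θ * n : ℝ) : AddCircle (1 : ℝ)) = η n := by
  have hM : ∀ i, 2 ≤ M i := fun i => by
    have := Nat.le_of_dvd (hpos i) (hdiv i)
    omega
  obtain ⟨θ, r, hr, hrpos, hθ⟩ := exists_int_add_small_mul_prod M hmono hM
  simp only [← hN] at hθ
  have hirr : Irrational θ := irrational_of_mul_eq_int_add_small θ N r hr hrpos hθ
  refine ⟨θ, hirr, fun η hη => ?_⟩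
  set x : ℕ → AddCircle (1 : ℝ) := fun a => ((θ * N a : ℝ) : AddCircle (1 : ℝ)) with hx
  have hx0 : Tendsto x atTop (nhds 0) := by
    have hxr : x = fun a => ((r a : ℝ) : AddCircle (1 : ℝ)) := by
      funext a
      obtain ⟨z, hz⟩ := hθ a
      have hz0 : ((z : ℝ) : AddCircle (1 : ℝ)) = 0 :=
        (AddCircle.coe_eq_zero_iff (1 : ℝ)).2 ⟨z, by simp⟩
      simp only [hx, hz, AddCircle.coe_add, hz0, zero_add]
    rw [hxr]
    exact ((AddCircle.continuous_mk' (1 : ℝ)).tendsto 0).comp hr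
  have hK : IsCompact (insert 0 (Set.range x)) := hx0.isCompact_insert_range
  have hKc : (insert 0 (Set.range x)).Countable := (Set.countable_range x).insert 0
  have hatoms : NullSingletonClass (volume : Measure (AddCircle (1 : ℝ))) :=
    ⟨fun y => by rw [← Metric.closedBall_zero, AddCircle.volume_closedBall]; simp⟩
  refine exists_ae_continuousAt_extension volume (injective_natCast_mul_addCircle hirr)
    ((hK.prod hK).image continuous_add).isClosed ((hKc.prod hKc).image _) ?_ η hη
  rw [hS]
  rintro _ ⟨a, b, -, rfl⟩
  refine ⟨(x a, x b), ⟨Or.inr ⟨a, rfl⟩, Or.inr ⟨b, rfl⟩⟩, ?_⟩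
  simp only [hx, ← AddCircle.coe_add, ← mul_add, ← Nat.cast_add]
end
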